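/- arXiv:2306.03339 — 2 statements merged into one kernel-verified Lean document; each statement's English description precedes it below -/
import Mathlib

section
/- For all real $y \ge 53$, $\prod_{p \le y} (1 + 2/p) < (\log y)^2$, where the product is over primes $p \le y$. -/
open Finset
open scoped Classical

namespace PrimeProd
open ArithmeticFunction (vonMangoldt)

/-- The Chebyshev function at natural numbers. -/
noncomputable def psiN (n : ℕ) : ℝ := ∑ k ∈ Ioc 0 n, vonMangoldt k

theorem log_fact_eq (n : ℕ) :
    Real.log (n.factorial) = ∑ k ∈ Ioc 0 n, vonMangoldt k * ((n / k : ℕ) : ℝ) := by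
  rw [← ArithmeticFunction.sum_Ioc_mul_zeta_eq_sum, ArithmeticFunction.vonMangoldt_mul_zeta]
  induction n with
  | zero => simp
  | succ m ih =>
    rw [Finset.sum_Ioc_succ_top (by omega), ← ih, Nat.factorial_succ, Nat.cast_mul,
      Real.log_mul (by positivity) (by positivity), ArithmeticFunction.log_apply]
    ring

theorem log_fact_div_eq (n m : ℕ) :
    Real.log ((n / m).factorial) = ∑ k ∈ Ioc 0 n, vonMangoldt k * ((n / k / m : ℕ) : ℝ) := by
  rw [log_fact_eq]
  have h : Ioc 0 (n / m) ⊆ Ioc 0 n := Finset.Ioc_subset_Ioc_right (Nat.div_le_self _ _)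
  rw [← Finset.sum_subset h]
  · refine Finset.sum_congr rfl fun k _ => ?_
    rw [Nat.div_div_eq_div_mul, Nat.div_div_eq_div_mul, mul_comm m k]
  · intro k hk hk'
    have : n / k / m = 0 := by
      rw [Nat.div_div_eq_div_mul, mul_comm, ← Nat.div_div_eq_div_mul]
      apply Nat.div_eq_of_lt
      simp only [Finset.mem_Ioc] at hk hk'
      omega
    simp [this]

theorem log_fact_lower (n : ℕ) (hn : 1 ≤ n) :
    (n : ℝ) * Real.log n - n + 1 ≤ Real.log (n.factorial) := by
  induction n, hn using Nat.le_induction with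
  | base => simp
  | succ m hm ih =>
    have hm0 : (0 : ℝ) < m := by exact_mod_cast hm
    rw [Nat.factorial_succ, Nat.cast_mul, Real.log_mul (by positivity) (by positivity)]
    have h := Real.log_le_sub_one_of_pos (show (0 : ℝ) < (m + 1 : ℝ) / m by positivity)
    rw [Real.log_div (by positivity) (by positivity)] at h
    have h2 : (m : ℝ) * (Real.log (m + 1) - Real.log m) ≤ m * ((m + 1) / m - 1) := by gcongr
    have h3 : (m : ℝ) * ((m + 1) / m - 1) = 1 := by field_simp; ring
    push_cast
    linarith

theorem log_fact_upper (n : ℕ) (hn : 1 ≤ n) :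
    Real.log (n.factorial) ≤ (n : ℝ) * Real.log n - n + 1 + Real.log n := by
  induction n, hn using Nat.le_induction with
  | base => simp
  | succ m hm ih =>
    have hm0 : (0 : ℝ) < m := by exact_mod_cast hm
    rw [Nat.factorial_succ, Nat.cast_mul, Real.log_mul (by positivity) (by positivity)]
    have h := Real.log_le_sub_one_of_pos (show (0 : ℝ) < (m : ℝ) / (m + 1) by positivity)
    rw [Real.log_div (by positivity) (by positivity)] at h
    have h2 : (m + 1 : ℝ) * (Real.log m - Real.log (m + 1)) ≤ (m + 1) * (m / (m + 1) - 1) := by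
      gcongr
    have h3 : (m + 1 : ℝ) * (m / (m + 1) - 1) = -1 := by field_simp; ring
    push_cast
    linarith

/-- lower bound for `log ⌊n/m⌋!` with real `n/m`. -/
theorem log_fact_div_lower (n m : ℕ) (hm : 1 ≤ m) (h : m ≤ n) :
    (n : ℝ) / m * (Real.log n - Real.log m) - n / m + 1 - Real.log n
      ≤ Real.log ((n / m).factorial) := by
  have hq : 1 ≤ n / m := (Nat.one_le_div_iff (by omega)).2 h
  have h1 := log_fact_lower (n / m) hq
  have hm0 : (1 : ℝ) ≤ m := by exact_mod_cast hm
  have hn0 : (1 : ℝ) ≤ n := by exact_mod_cast (by omega : 1 ≤ n)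
  set x : ℝ := (n : ℝ) / m with hx
  have hlx : Real.log n - Real.log m = Real.log x := by
    rw [hx, Real.log_div (by positivity) (by positivity)]
  have hlx2 : Real.log x ≤ Real.log n := by
    rw [← hlx]; linarith [Real.log_nonneg hm0]
  have hx1 : 1 ≤ x := by rw [hx, one_le_div (by linarith)]; exact_mod_cast h
  rw [hlx]
  set q : ℝ := ((n / m : ℕ) : ℝ) with hqd
  have hq1 : (1 : ℝ) ≤ q := by rw [hqd]; exact_mod_cast hq
  have hxq : x < q + 1 := by
    rw [hx, hqd, div_lt_iff₀ (by linarith)]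
    have := Nat.lt_mul_div_succ n (show 0 < m by omega)
    rw [mul_comm] at this
    exact_mod_cast this
  have h := Real.log_le_sub_one_of_pos (show (0 : ℝ) < x / q by positivity)
  rw [Real.log_div (by positivity) (by positivity)] at h
  have h2 : q * (Real.log x - Real.log q) ≤ q * (x / q - 1) := by gcongr
  have h3 : q * (x / q - 1) = x - q := by field_simp
  have h4 : (x - q) * Real.log x ≤ 1 * Real.log x := by
    apply mul_le_mul_of_nonneg_right (by linarith) (Real.log_nonneg hx1)
  nlinarith

theorem log_fact_div_upper (n m : ℕ) (hm : 1 ≤ m) (h : m ≤ n) :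
    Real.log ((n / m).factorial) ≤
      (n : ℝ) / m * (Real.log n - Real.log m) - n / m + 1 + Real.log n := by
  have hq : 1 ≤ n / m := (Nat.one_le_div_iff (by omega)).2 h
  have h1 := log_fact_upper (n / m) hq
  have hm0 : (1 : ℝ) ≤ m := by exact_mod_cast hm
  have hn0 : (1 : ℝ) ≤ n := by exact_mod_cast (by omega : 1 ≤ n)
  set x : ℝ := (n : ℝ) / m with hx
  have hlx : Real.log n - Real.log m = Real.log x := by
    rw [hx, Real.log_div (by positivity) (by positivity)]
  have hlx2 : Real.log x ≤ Real.log n := by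
    rw [← hlx]; linarith [Real.log_nonneg hm0]
  have hx1 : 1 ≤ x := by rw [hx, one_le_div (by linarith)]; exact_mod_cast h
  rw [hlx]
  set q : ℝ := ((n / m : ℕ) : ℝ) with hqd
  have hq1 : (1 : ℝ) ≤ q := by rw [hqd]; exact_mod_cast hq
  have hxq : q ≤ x := Nat.cast_div_le
  have h := Real.log_le_sub_one_of_pos (show (0 : ℝ) < q / x by positivity)
  rw [Real.log_div (by positivity) (by positivity)] at h
  have h2 : x * (Real.log q - Real.log x) ≤ x * (q / x - 1) := by gcongr
  have h3 : x * (q / x - 1) = q - x := by field_simp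
  have h4 : 0 ≤ (x - q) * Real.log q :=
    mul_nonneg (by linarith) (Real.log_nonneg hq1)
  have h5 : Real.log q ≤ Real.log x := Real.log_le_log (by linarith) hxq
  nlinarith

theorem cheb_step (n : ℕ) (hn : 1000 ≤ n) :
    psiN n ≤ psiN (n / 6) + (5 / 6 * (5 / 3 * Real.log 2)) * n := by
  have key : psiN n - psiN (n / 6) ≤ Real.log ((n / 1).factorial) - Real.log ((n / 2).factorial)
      - Real.log ((n / 3).factorial) - Real.log ((n / 5).factorial)
      + Real.log ((n / 30).factorial) := by
    have e6 : psiN (n / 6) = ∑ k ∈ Ioc 0 n, if k ≤ n / 6 then vonMangoldt k else 0 := by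
      rw [psiN, ← Finset.sum_filter]
      apply Finset.sum_congr _ (fun _ _ => rfl)
      ext k; simp only [Finset.mem_Ioc, Finset.mem_filter]; omega
    rw [e6, psiN, log_fact_div_eq, log_fact_div_eq, log_fact_div_eq, log_fact_div_eq,
      log_fact_div_eq, ← Finset.sum_sub_distrib, ← Finset.sum_sub_distrib,
      ← Finset.sum_sub_distrib, ← Finset.sum_sub_distrib, ← Finset.sum_add_distrib]
    refine Finset.sum_le_sum fun k hk => ?_
    simp only [Finset.mem_Ioc] at hk
    have hL : 0 ≤ vonMangoldt k := ArithmeticFunction.vonMangoldt_nonneg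
    set q := n / k with hq
    have hq1 : 1 ≤ q := (Nat.one_le_div_iff (by omega)).2 hk.2
    split_ifs with hle
    · have : (q / 2 + q / 3 + q / 5 : ℕ) ≤ q / 1 + q / 30 := by omega
      have : ((q / 2 : ℕ) : ℝ) + (q / 3 : ℕ) + (q / 5 : ℕ) ≤ (q / 1 : ℕ) + (q / 30 : ℕ) := by
        exact_mod_cast this
      nlinarith
    · have hq6 : q < 6 := by
        rw [hq, Nat.div_lt_iff_lt_mul (by omega)]
        omega
      have : (1 + q / 2 + q / 3 + q / 5 : ℕ) ≤ q / 1 + q / 30 := by omega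
      have : 1 + ((q / 2 : ℕ) : ℝ) + (q / 3 : ℕ) + (q / 5 : ℕ) ≤ (q / 1 : ℕ) + (q / 30 : ℕ) := by
        exact_mod_cast this
      nlinarith
  have u1 := log_fact_div_upper n 1 (by norm_num) (by omega)
  have u30 := log_fact_div_upper n 30 (by norm_num) (by omega)
  have l2 := log_fact_div_lower n 2 (by norm_num) (by omega)
  have l3 := log_fact_div_lower n 3 (by norm_num) (by omega)
  have l5 := log_fact_div_lower n 5 (by norm_num) (by omega)
  have hx : (1000 : ℝ) ≤ n := by exact_mod_cast hn
  push_cast at u1 u30 l2 l3 l5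
  have h30 : Real.log 30 = Real.log 2 + Real.log 3 + Real.log 5 := by
    rw [← Real.log_mul (by norm_num) (by norm_num), ← Real.log_mul (by norm_num) (by norm_num)]
    norm_num
  have h3 : 5 * Real.log 3 ≤ 8 * Real.log 2 := by
    have := Real.log_le_log (show (0 : ℝ) < 3 ^ 5 by norm_num)
      (show (3 : ℝ) ^ 5 ≤ 2 ^ 8 by norm_num)
    rw [Real.log_pow, Real.log_pow] at this; exact_mod_cast this
  have h5 : 3 * Real.log 5 ≤ 7 * Real.log 2 := by
    have := Real.log_le_log (show (0 : ℝ) < 5 ^ 3 by norm_num)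
      (show (5 : ℝ) ^ 3 ≤ 2 ^ 7 by norm_num)
    rw [Real.log_pow, Real.log_pow] at this; exact_mod_cast this
  have hlog : Real.log n ≤ 10 * Real.log 2 + n / 1024 - 1 := by
    have := Real.log_le_sub_one_of_pos (show (0 : ℝ) < (n : ℝ) / 2 ^ 10 by positivity)
    rw [Real.log_div (by positivity) (by positivity), Real.log_pow] at this
    norm_num at this ⊢
    linarith
  have g2 := Real.log_two_gt_d9
  have g2' := Real.log_two_lt_d9
  rw [h30] at u30
  simp only [Real.log_one] at u1
  set x : ℝ := (n : ℝ)
  have hα : x * (7 / 15 * Real.log 2 + 3 / 10 * Real.log 3 + 1 / 6 * Real.log 5)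
      ≤ x * ((7 / 15 + 12 / 25 + 7 / 18) * Real.log 2) := by
    apply mul_le_mul_of_nonneg_left _ (by linarith)
    linarith
  have hfin : 0 ≤ (x - 1000) * (Real.log 2 - 0.69) := mul_nonneg (by linarith) (by linarith)
  nlinarith

/-- Evaluate `x` before passing it on (useful for kernel computation). -/
def force {α : Type} (x : ℕ) (k : ℕ → α) : α := Nat.rec (k 0) (fun m _ => k (m + 1)) x

theorem force_eq {α : Type} (x : ℕ) (k : ℕ → α) : force x k = k x := by
  cases x <;> rfl

def lcmGo : ℕ → ℕ → ℕ → Bool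
  | 0, _, _ => true
  | f + 1, n, L => Nat.ble (L ^ 3) (2 ^ (5 * n)) &&
      force (n + 1) fun n' => force (L * n' / Nat.gcd L n') fun L' => lcmGo f n' L'

theorem lcmUpto_succ (n : ℕ) : Nat.lcmUpto (n + 1) = Nat.lcm (Nat.lcmUpto n) (n + 1) := by
  rw [Nat.lcmUpto, Nat.lcmUpto, ← Finset.insert_Icc_right_eq_Icc_add_one (by omega),
    Finset.lcm_insert]
  exact Nat.lcm_comm _ _

theorem lcmGo_spec (f : ℕ) : ∀ n L : ℕ, lcmGo f n L = true → L = Nat.lcmUpto n →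
    ∀ m, n ≤ m → m < n + f → Nat.lcmUpto m ^ 3 ≤ 2 ^ (5 * m) := by
  induction f with
  | zero => intro n L _ _ m h1 h2; omega
  | succ f ih =>
    intro n L h hL m h1 h2
    simp only [lcmGo, force_eq, Bool.and_eq_true, Nat.ble_eq] at h
    rcases Nat.eq_or_lt_of_le h1 with h3 | h3
    · rw [← h3, ← hL]; exact h.1
    · refine ih (n + 1) _ h.2 ?_ m (by omega) (by omega)
      rw [lcmUpto_succ, ← hL]; rfl

theorem lcm_small (m : ℕ) (hm : m < 1000) : Nat.lcmUpto m ^ 3 ≤ 2 ^ (5 * m) :=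
  lcmGo_spec 1000 0 1 (by decide +kernel) (by simp [Nat.lcmUpto]) m (by omega) (by omega)

theorem psiN_eq_log (n : ℕ) : psiN n = Real.log (Nat.lcmUpto n) := by
  rw [← Chebyshev.psi_eq_log_lcmUpto, psiN, Chebyshev.psi, Nat.floor_natCast]

theorem psiN_le (n : ℕ) : psiN n ≤ (5 / 3 * Real.log 2) * n := by
  induction n using Nat.strong_induction_on with
  | _ n ih =>
    rcases lt_or_ge n 1000 with h | h
    · have h1 := lcm_small n h
      have hp : (0 : ℝ) < Nat.lcmUpto n := by exact_mod_cast Nat.lcmUpto_pos n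
      have h2 : ((Nat.lcmUpto n : ℝ)) ^ 3 ≤ 2 ^ (5 * n) := by exact_mod_cast h1
      have h3 := Real.log_le_log (by positivity) h2
      rw [Real.log_pow, Real.log_pow] at h3
      rw [psiN_eq_log]
      push_cast at h3
      linarith
    · have h1 := cheb_step n h
      have h2 := ih (n / 6) (by omega)
      have h3 : ((n / 6 : ℕ) : ℝ) ≤ (n : ℝ) / 6 := by
        simpa using (Nat.cast_div_le (m := n) (n := 6) (α := ℝ))
      have h4 : (5 / 3 * Real.log 2) * ((n / 6 : ℕ) : ℝ) ≤ (5 / 3 * Real.log 2) * ((n : ℝ) / 6) := by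
        apply mul_le_mul_of_nonneg_left h3
        have := Real.log_two_gt_d9; linarith
      linarith

/-- Abel summation comparison. -/
theorem abel_le (b d g : ℕ → ℝ) (N : ℕ) (c : ℝ)
    (h : ∀ m, N ≤ m → ∑ k ∈ Ioc N m, b k ≤ c + ∑ k ∈ Ioc N m, d k)
    (hg : ∀ m, N < m → g (m + 1) ≤ g m) (M : ℕ) (hM : N ≤ M) (hg0 : 0 ≤ g (M + 1)) :
    ∑ k ∈ Ioc N M, b k * g k ≤ c * g (N + 1) + ∑ k ∈ Ioc N M, d k * g k := by
  have key : ∀ M, N ≤ M → (c + ∑ k ∈ Ioc N M, d k - ∑ k ∈ Ioc N M, b k) * g (M + 1) ≤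
      c * g (N + 1) + ∑ k ∈ Ioc N M, d k * g k - ∑ k ∈ Ioc N M, b k * g k := by
    intro M hM
    induction M, hM using Nat.le_induction with
    | base => simp
    | succ m hm ih =>
      have h1 := h (m + 1) (by omega)
      have h2 := hg (m + 1) (by omega)
      rw [Finset.sum_Ioc_succ_top (by omega), Finset.sum_Ioc_succ_top (by omega)] at h1
      rw [Finset.sum_Ioc_succ_top (by omega), Finset.sum_Ioc_succ_top (by omega),
        Finset.sum_Ioc_succ_top (by omega), Finset.sum_Ioc_succ_top (by omega)]
      have h3 := mul_nonneg (sub_nonneg.2 h1) (sub_nonneg.2 h2)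
      nlinarith
  have h1 := key M hM
  have h2 := mul_nonneg (sub_nonneg.2 (h M hM)) hg0
  linarith

noncomputable def B (n : ℕ) : ℝ := ∑ k ∈ Ioc 0 n, vonMangoldt k / k

theorem sum_inv_le (m M : ℕ) (hm : 1 ≤ m) (h : m ≤ M) :
    ∑ k ∈ Ioc m M, (1 : ℝ) / k ≤ Real.log M - Real.log m := by
  induction M, h using Nat.le_induction with
  | base => simp
  | succ n hn ih =>
    rw [Finset.sum_Ioc_succ_top (by omega)]
    have hn0 : (0 : ℝ) < n := by exact_mod_cast (by omega : 0 < n)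
    have h := Real.log_le_sub_one_of_pos (show (0 : ℝ) < (n : ℝ) / (n + 1) by positivity)
    rw [Real.log_div (by positivity) (by positivity)] at h
    have h3 : (n : ℝ) / (n + 1) - 1 = - (1 / (n + 1)) := by field_simp; ring
    push_cast
    linarith

theorem mertens_aux (M : ℕ) (hM : 16384 ≤ M) :
    B M * M ≤ Real.log (M.factorial) + (5 / 3 * Real.log 2) * (M * Real.log 2 + 2) := by
  have hM0 : (16384 : ℝ) ≤ M := by exact_mod_cast hM
  set g : ℕ → ℝ := fun k => max 0 (min 1 ((M : ℝ) / k - 1)) with hgdef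
  have ha : 0 ≤ 5 / 3 * Real.log 2 := by have := Real.log_two_gt_d9; linarith
  have h1 : B M * M ≤ Real.log (M.factorial) + ∑ k ∈ Ioc 0 M, vonMangoldt k * g k := by
    rw [log_fact_eq, B, Finset.sum_mul, ← Finset.sum_add_distrib]
    refine Finset.sum_le_sum fun k hk => ?_
    simp only [Finset.mem_Ioc] at hk
    have hL : 0 ≤ vonMangoldt k := ArithmeticFunction.vonMangoldt_nonneg
    have hk0 : (0 : ℝ) < k := by exact_mod_cast hk.1
    have e : vonMangoldt k / k * M = vonMangoldt k * ((M : ℝ) / k) := by ring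
    rw [e, ← mul_add]
    apply mul_le_mul_of_nonneg_left _ hL
    have hq1 : (1 : ℝ) ≤ ((M / k : ℕ) : ℝ) := by
      exact_mod_cast (Nat.one_le_div_iff (by omega)).2 hk.2
    have hq2 : (M : ℝ) / k ≤ ((M / k : ℕ) : ℝ) + 1 := by
      rw [div_le_iff₀ hk0]
      have := Nat.lt_mul_div_succ M hk.1
      rw [mul_comm] at this
      exact_mod_cast this.le
    have : (M : ℝ) / k - ((M / k : ℕ) : ℝ) ≤ g k :=
      le_max_of_le_right (le_min (by linarith) (by linarith))
    linarith
  have h2 : ∑ k ∈ Ioc 0 M, vonMangoldt k * g k ≤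
      0 * g (0 + 1) + ∑ k ∈ Ioc 0 M, (5 / 3 * Real.log 2) * g k := by
    apply abel_le (fun k => vonMangoldt k) (fun _ => 5 / 3 * Real.log 2) g 0 0
    · intro m _
      have := psiN_le m
      rw [psiN] at this
      simp only [Finset.sum_const, Nat.card_Ioc, nsmul_eq_mul]
      simp only [Nat.sub_zero]
      linarith
    · intro m hm
      have : (0 : ℝ) < m := by exact_mod_cast hm
      simp only [hgdef]
      gcongr
      linarith
    · omega
    · exact le_max_left _ _
  rw [← Finset.mul_sum] at h2
  have h3 : ∑ k ∈ Ioc 0 M, g k ≤ M * Real.log 2 + 2 := by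
    have hm1 : M / 2 ≤ M := Nat.div_le_self _ _
    rw [← Finset.sum_Ioc_consecutive _ (Nat.zero_le (M / 2)) hm1]
    have s1 : ∑ k ∈ Ioc 0 (M / 2), g k ≤ ((M / 2 : ℕ) : ℝ) := by
      calc _ ≤ ∑ k ∈ Ioc 0 (M / 2), (1 : ℝ) :=
            Finset.sum_le_sum fun k _ => max_le zero_le_one (min_le_left _ _)
        _ = _ := by simp
    have s2 : ∑ k ∈ Ioc (M / 2) M, g k ≤ ∑ k ∈ Ioc (M / 2) M, ((M : ℝ) * (1 / k) - 1) := by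
      refine Finset.sum_le_sum fun k hk => ?_
      simp only [Finset.mem_Ioc] at hk
      have hk0 : (0 : ℝ) < k := by exact_mod_cast (by omega : 0 < k)
      have : (1 : ℝ) ≤ M / k := by rw [one_le_div hk0]; exact_mod_cast hk.2
      rw [mul_one_div]
      exact max_le (by linarith) (min_le_right _ _)
    rw [Finset.sum_sub_distrib, ← Finset.mul_sum] at s2
    have s3 := sum_inv_le (M / 2) M (by omega) hm1
    have s4 : (M : ℝ) * ∑ k ∈ Ioc (M / 2) M, (1 : ℝ) / k ≤
      M * (Real.log M - Real.log (M / 2 : ℕ)) := by gcongr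
    simp only [Finset.sum_const, Nat.card_Ioc, nsmul_eq_mul, mul_one] at s2
    rw [Nat.cast_sub hm1] at s2
    set m : ℝ := ((M / 2 : ℕ) : ℝ) with hm
    have hmu : 2 * m ≤ M := by
      rw [hm]; exact_mod_cast (by omega : 2 * (M / 2) ≤ M)
    have hml : (M : ℝ) ≤ 2 * m + 1 := by
      rw [hm]; exact_mod_cast (by omega : M ≤ 2 * (M / 2) + 1)
    have hmp : 0 < m := by linarith
    have s5 := Real.log_le_sub_one_of_pos (show (0 : ℝ) < (M : ℝ) / (2 * m) by positivity)
    rw [Real.log_div (by positivity) (by positivity),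
      Real.log_mul (by norm_num) (by positivity)] at s5
    have s6 : (M : ℝ) / (2 * m) - 1 ≤ 2 / M := by
      rw [div_sub_one (by positivity), div_le_div_iff₀ (by positivity) (by positivity)]
      nlinarith
    have s7 : (M : ℝ) * (Real.log M - Real.log m) ≤ M * (Real.log 2 + 2 / M) := by
      gcongr; linarith
    have s8 : (M : ℝ) * (Real.log 2 + 2 / M) = M * Real.log 2 + 2 := by
      have : (M : ℝ) ≠ 0 := by positivity
      field_simp
    linarith
  have h4 := mul_le_mul_of_nonneg_left h3 ha
  linarith

theorem mertens_upper (M : ℕ) (hM : 16384 ≤ M) :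
    B M ≤ Real.log M - 1 + 5 / 3 * Real.log 2 ^ 2 + 1 / 1000 := by
  have h1 := mertens_aux M hM
  have h2 := log_fact_upper M (by omega)
  have hx : (16384 : ℝ) ≤ M := by exact_mod_cast hM
  have g2 := Real.log_two_gt_d9
  have g2' := Real.log_two_lt_d9
  have hlog : Real.log M ≤ 14 * Real.log 2 + M / 16384 - 1 := by
    have := Real.log_le_sub_one_of_pos (show (0 : ℝ) < (M : ℝ) / 2 ^ 14 by positivity)
    rw [Real.log_div (by positivity) (by positivity), Real.log_pow] at this
    norm_num at this ⊢
    linarith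
  have h3 : B M * M ≤ (Real.log M - 1 + 5 / 3 * Real.log 2 ^ 2 + 1 / 1000) * M := by
    nlinarith
  exact le_of_mul_le_mul_right h3 (by linarith)

theorem recip_sum_le (N M : ℕ) (hN : 16384 ≤ N) (hNM : N ≤ M) (c : ℝ)
    (hc : Real.log N - 1 + 5 / 3 * Real.log 2 ^ 2 + 1 / 1000 - B N ≤ c) :
    ∑ k ∈ Ioc N M, vonMangoldt k / k * (1 / Real.log k) ≤
      c * (1 / Real.log N) + (Real.log (Real.log M) - Real.log (Real.log N)) := by
  have hc0 : 0 ≤ c := by have := mertens_upper N hN; linarith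
  have hlogpos : ∀ m, N ≤ m → 0 < Real.log m := fun m hm =>
    Real.log_pos (by exact_mod_cast (by omega : 1 < m))
  have tele : ∀ m, N ≤ m → ∑ k ∈ Ioc N m, (Real.log k - Real.log (k - 1 : ℕ)) =
      Real.log m - Real.log N := by
    intro m hm
    induction m, hm using Nat.le_induction with
    | base => simp
    | succ n hn ih =>
      rw [Finset.sum_Ioc_succ_top (by omega), ih, Nat.add_sub_cancel]; ring
  have h := abel_le (fun k => vonMangoldt k / k)
    (fun k => Real.log k - Real.log (k - 1 : ℕ)) (fun k => 1 / Real.log k) N c ?_ ?_ M hNM ?_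
  · refine h.trans ?_
    have h1 : c * (1 / Real.log (N + 1 : ℕ)) ≤ c * (1 / Real.log N) := by
      have := hlogpos N le_rfl
      gcongr
      omega
    have h2 : ∑ k ∈ Ioc N M, (Real.log k - Real.log (k - 1 : ℕ)) * (1 / Real.log k) ≤
        Real.log (Real.log M) - Real.log (Real.log N) := by
      clear h h1
      induction M, hNM using Nat.le_induction with
      | base => simp
      | succ n hn ih =>
        rw [Finset.sum_Ioc_succ_top (by omega), Nat.add_sub_cancel]
        have p1 := hlogpos n hn
        have p2 := hlogpos (n + 1) (by omega)
        have h := Real.log_le_sub_one_of_pos (div_pos p1 p2)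
        rw [Real.log_div p1.ne' p2.ne'] at h
        have e : (Real.log (n + 1 : ℕ) - Real.log n) * (1 / Real.log (n + 1 : ℕ)) =
          1 - Real.log n / Real.log (n + 1 : ℕ) := by field_simp
        rw [e]; linarith
    linarith
  · intro m hm
    rw [tele m hm]
    have h1 := mertens_upper m (by omega)
    have h2 : B m = B N + ∑ k ∈ Ioc N m, vonMangoldt k / k := by
      rw [B, B, Finset.sum_Ioc_consecutive _ (Nat.zero_le _) hm]
    linarith
  · intro m hm
    have := hlogpos m hm.le
    refine one_div_le_one_div_of_le this (Real.log_le_log ?_ ?_)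
    · exact_mod_cast (by omega : 0 < m)
    · exact_mod_cast (by omega : m ≤ m + 1)
  · have := hlogpos (M + 1) (by omega)
    positivity

/- Kernel computation up to `2 ^ 14` -/

def smallList : List ℕ := [2, 3, 5, 7, 11, 13, 17, 19, 23, 29, 31, 37, 41, 43, 47, 53, 59, 61,
  67, 71, 73, 79, 83, 89, 97, 101, 103, 107, 109, 113, 127]

/-- The product of the primes below 128. -/
def Mp : ℕ := 4014476939333036189094441199026045136645885247730

def isP (n : ℕ) : Bool :=
  bif Nat.ble n 127 then Nat.testBit 170152392186162032610075049835446806700 n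
  else Nat.beq (Nat.gcd n Mp) 1

theorem Mp_eq : Mp = smallList.prod := by decide +kernel

theorem small_spec : ∀ n < 128,
    (Nat.testBit 170152392186162032610075049835446806700 n = true ↔ Nat.Prime n) ∧
    (Nat.Prime n → n ∣ Mp) := by
  simp only [Nat.prime_def_lt]
  decide +kernel

theorem isP_spec (n : ℕ) (hn : n < 16384) : isP n = true ↔ Nat.Prime n := by
  unfold isP
  rcases Nat.lt_or_ge n 128 with h | h
  · have : Nat.ble n 127 = true := by rw [Nat.ble_eq]; omega
    rw [this, cond_true]
    exact (small_spec n h).1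
  · have : Nat.ble n 127 = false := by
      rw [← Bool.not_eq_true, Nat.ble_eq]; omega
    rw [this, cond_false, Nat.beq_eq]
    constructor
    · intro hg
      by_contra hp
      have h1 := Nat.minFac_sq_le_self (by omega : 0 < n) hp
      have h2 : n.minFac < 128 := by nlinarith
      have h3 := Nat.minFac_prime (by omega : n ≠ 1)
      have h4 := (small_spec _ h2).2 h3
      have h5 := Nat.dvd_gcd (Nat.minFac_dvd n) h4
      rw [hg] at h5
      exact h3.one_lt.ne' (Nat.dvd_one.1 h5)
    · intro hp
      rcases (Nat.coprime_or_dvd_of_prime hp Mp) with h1 | h1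
      · exact h1
      · exfalso
        rw [Mp_eq, hp.prime.dvd_prod_iff] at h1
        obtain ⟨a, ha, hd⟩ := h1
        have : ∀ a ∈ smallList, 0 < a ∧ a < 128 := by decide
        have h2 := this a ha
        have := Nat.le_of_dvd h2.1 hd
        omega

def numT : ℕ → ℕ → ℕ
  | 0, lo => bif isP lo then lo + 2 else 1
  | k + 1, lo => numT k lo * force (lo + 2 ^ k) fun m => numT k m

def denT : ℕ → ℕ → ℕ
  | 0, lo => bif isP lo then lo else 1
  | k + 1, lo => denT k lo * force (lo + 2 ^ k) fun m => denT k m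

/-- Binary search for a lower bound of the binary logarithm. -/
def lgGo (m : ℕ) : ℕ → ℕ → ℕ
  | 0, e => e
  | i + 1, e => force (e + 2 ^ i) fun e' => bif Nat.ble (2 ^ e') m then lgGo m i e' else lgGo m i e

def lg (x : ℕ) : ℕ := force x fun m => lgGo m 12 0

theorem lgGo_spec (m i : ℕ) : ∀ e, 2 ^ e ≤ m → 2 ^ lgGo m i e ≤ m := by
  induction i with
  | zero => intro e h; exact h
  | succ i ih =>
    intro e h
    simp only [lgGo, force_eq]
    rcases hc : Nat.ble (2 ^ (e + 2 ^ i)) m with _ | _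
    · exact ih _ h
    · exact ih _ (by rwa [Nat.ble_eq] at hc)

theorem lg_spec (m : ℕ) (hm : 0 < m) : 2 ^ lg m ≤ m := by
  rw [lg, force_eq]; exact lgGo_spec m 12 0 (by rw [pow_zero]; exact hm)

def leafB (n : ℕ) : ℕ :=
  force (Nat.gcd n Mp) fun g => force (bif Nat.beq g 1 then n else g) fun b =>
    bif isP b && Nat.beq (b ^ 14 % n) 0 then lg (b ^ 256) * 2 ^ 20 / n else 0

def valT : ℕ → ℕ → ℕ
  | 0, lo => leafB lo
  | k + 1, lo => valT k lo + force (lo + 2 ^ k) fun m => valT k m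

noncomputable def fac (n : ℕ) : ℝ := if n.Prime then 1 + 2 / (n : ℝ) else 1

/-- The product over the primes below `n`. -/
noncomputable def Pr (n : ℕ) : ℝ := ∏ k ∈ Ico 0 n, fac k

theorem one_le_fac (n : ℕ) : 1 ≤ fac n := by
  unfold fac
  split_ifs
  · have : 0 ≤ 2 / (n : ℝ) := by positivity
    linarith
  · exact le_rfl

theorem Pr_mono {a b : ℕ} (h : a ≤ b) : Pr a ≤ Pr b := by
  unfold Pr
  rw [← Finset.prod_Ico_consecutive _ (Nat.zero_le a) h]
  refine le_mul_of_one_le_right (Finset.prod_nonneg fun k _ => by linarith [one_le_fac k]) ?_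
  calc (1 : ℝ) = ∏ k ∈ Ico a b, (1 : ℝ) := by simp
    _ ≤ _ := Finset.prod_le_prod (fun _ _ => zero_le_one) fun k _ => one_le_fac k

theorem tree_spec (k : ℕ) : ∀ lo, lo + 2 ^ k ≤ 16384 → 0 < denT k lo ∧
    (numT k lo : ℝ) / denT k lo = ∏ n ∈ Ico lo (lo + 2 ^ k), fac n := by
  induction k with
  | zero =>
    intro lo h
    have hs := isP_spec lo (by simpa using h)
    simp only [numT, denT, pow_zero, Nat.Ico_succ_singleton, Finset.prod_singleton, fac]
    by_cases hp : lo.Prime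
    · have h0 := hp.pos
      have : (lo : ℝ) ≠ 0 := by exact_mod_cast h0.ne'
      simp only [hs.2 hp, cond_true, hp, if_true]
      refine ⟨h0, ?_⟩
      push_cast
      field_simp
    · have : isP lo = false := by rw [← Bool.not_eq_true, hs]; exact hp
      simp [this, hp]
  | succ k ih =>
    intro lo h
    rw [pow_succ] at h
    have h1 := ih lo (by omega)
    have h2 := ih (lo + 2 ^ k) (by omega)
    simp only [numT, denT, force_eq]
    refine ⟨Nat.mul_pos h1.1 h2.1, ?_⟩
    push_cast
    rw [mul_div_mul_comm, h1.2, h2.2, Finset.prod_Ico_consecutive _ (by omega) (by omega)]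
    congr 2
    rw [pow_succ]; omega

theorem log2_le (n K : ℕ) (hn : 0 < n) :
    (lg (n ^ K) : ℝ) * Real.log 2 ≤ K * Real.log n := by
  have h : 2 ^ lg (n ^ K) ≤ n ^ K := lg_spec _ (by positivity)
  have h' : (2 : ℝ) ^ lg (n ^ K) ≤ (n : ℝ) ^ K := by exact_mod_cast h
  have := Real.log_le_log (by positivity) h'
  rwa [Real.log_pow, Real.log_pow] at this

theorem leafB_spec (n : ℕ) (hn : n < 16384) :
    (leafB n : ℝ) * Real.log 2 ≤ 256 * 2 ^ 20 * (vonMangoldt n / n) := by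
  have hl := Real.log_two_gt_d9
  have hL : 0 ≤ vonMangoldt n := ArithmeticFunction.vonMangoldt_nonneg
  have hz : ((0 : ℕ) : ℝ) * Real.log 2 ≤ 256 * 2 ^ 20 * (vonMangoldt n / n) := by
    rw [Nat.cast_zero, zero_mul]; positivity
  unfold leafB
  simp only [force_eq]
  rcases Nat.eq_zero_or_pos n with h0 | h0
  · subst h0
    simp
  set b := bif Nat.beq (Nat.gcd n Mp) 1 then n else Nat.gcd n Mp with hb
  have hbn : b ≤ n := by
    rw [hb]
    cases Nat.beq (Nat.gcd n Mp) 1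
    · exact Nat.gcd_le_left _ h0
    · exact le_rfl
  rcases hc : (isP b && Nat.beq (b ^ 14 % n) 0) with _ | _
  · simpa using hz
  · rw [cond_true]
    rw [Bool.and_eq_true, isP_spec b (by omega), Nat.beq_eq] at hc
    obtain ⟨hp, hd⟩ := hc
    have hd := Nat.dvd_of_mod_eq_zero hd
    obtain ⟨j, -, hj⟩ := (Nat.dvd_prime_pow hp).1 hd
    have hj0 : j ≠ 0 := by
      rintro rfl
      have := hp.two_le
      simp at hj
      omega
    have hΛ : vonMangoldt n = Real.log b := by
      rw [hj, ArithmeticFunction.vonMangoldt_apply_pow hj0,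
        ArithmeticFunction.vonMangoldt_apply_prime hp]
    rw [hΛ]
    have h1 := log2_le b 256 hp.pos
    have h2 : ((lg (b ^ 256) * 2 ^ 20 / n : ℕ) : ℝ) ≤
        ((lg (b ^ 256) * 2 ^ 20 : ℕ) : ℝ) / n := Nat.cast_div_le
    have hn0 : (0 : ℝ) < n := by exact_mod_cast h0
    calc _ ≤ ((lg (b ^ 256) * 2 ^ 20 : ℕ) : ℝ) / n * Real.log 2 := by
            apply mul_le_mul_of_nonneg_right h2; linarith
      _ = (lg (b ^ 256) : ℝ) * Real.log 2 * (2 ^ 20 / n) := by push_cast; ring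
      _ ≤ ((256 : ℕ) * Real.log b) * (2 ^ 20 / n) := by gcongr
      _ = _ := by push_cast; ring

theorem valT_spec (k : ℕ) : ∀ lo, lo + 2 ^ k ≤ 16384 →
    (valT k lo : ℝ) * Real.log 2 ≤
      256 * 2 ^ 20 * ∑ n ∈ Ico lo (lo + 2 ^ k), vonMangoldt n / n := by
  induction k with
  | zero =>
    intro lo h
    simp only [valT, pow_zero, Nat.Ico_succ_singleton, Finset.sum_singleton]
    exact leafB_spec lo (by simpa using h)
  | succ k ih =>
    intro lo h
    rw [pow_succ] at h
    have h1 := ih lo (by omega)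
    have h2 := ih (lo + 2 ^ k) (by omega)
    simp only [valT, force_eq]
    have e : lo + 2 ^ (k + 1) = lo + 2 ^ k + 2 ^ k := by rw [pow_succ]; omega
    rw [e, ← Finset.sum_Ico_consecutive _ (by omega : lo ≤ lo + 2 ^ k) (by omega)]
    push_cast
    linarith

theorem valT_val : Nat.ble 3533860000 (valT 14 0) = true := by decide +kernel

theorem B_lower : 9.125 ≤ B 16384 := by
  have h1 := valT_spec 14 0 (by norm_num)
  have h2 : (3533860000 : ℝ) ≤ valT 14 0 := by
    have := valT_val
    rw [Nat.ble_eq] at this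
    exact_mod_cast this
  have h3 : ∑ n ∈ Ico 0 (0 + 2 ^ 14), vonMangoldt n / n ≤ B 16384 := by
    unfold B
    rw [Finset.sum_Ioc_succ_top (by omega)]
    have : Ico 0 (0 + 2 ^ 14) = insert 0 (Ioc 0 16383) := by
      ext k; simp only [Finset.mem_Ico, Finset.mem_insert, Finset.mem_Ioc]; omega
    rw [this, Finset.sum_insert (by simp)]
    have hL : 0 ≤ vonMangoldt (16383 + 1) := ArithmeticFunction.vonMangoldt_nonneg
    have : 0 ≤ vonMangoldt (16383 + 1) / ((16383 + 1 : ℕ) : ℝ) := by positivity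
    simp only [Nat.cast_zero, div_zero, zero_add]
    linarith
  have g2 := Real.log_two_gt_d9
  nlinarith

def chk : List ℕ → ℕ → ℕ → ℕ → Bool
  | [], lo, a, b => Nat.beq lo 16384 && Nat.ble (a * 100) (b * 8582)
  | k :: ks, lo, a, b =>
    force (lo + 2 ^ k) fun l => Nat.ble l 16384 &&
    force (a * numT k lo) fun a' => force (b * denT k lo) fun b' =>
      Nat.blt (a' * (256 * 10 ^ 10) ^ 2) (b' * (lg (lo ^ 256) * 6931471803) ^ 2) &&
      chk ks l a' b'

theorem chk_spec (ks : List ℕ) : ∀ lo a b : ℕ, 53 ≤ lo → 0 < b → (a : ℝ) / b = Pr lo →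
    chk ks lo a b = true →
    (∀ n, lo ≤ n → n < 16384 → Pr (n + 1) < Real.log n ^ 2) ∧ Pr 16384 ≤ 85.82 := by
  induction ks with
  | nil =>
    intro lo a b h53 hb hab h
    simp only [chk, Bool.and_eq_true, Nat.beq_eq, Nat.ble_eq] at h
    obtain ⟨rfl, h⟩ := h
    refine ⟨fun n h1 h2 => by omega, ?_⟩
    have hb' : (0 : ℝ) < b := by exact_mod_cast hb
    have h' : (a : ℝ) * 100 ≤ b * 8582 := by exact_mod_cast h
    rw [← hab, div_le_iff₀ hb']
    linarith
  | cons k ks ih =>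
    intro lo a b h53 hb hab h
    simp only [chk, force_eq, Bool.and_eq_true, Nat.ble_eq] at h
    obtain ⟨hl, hlt, hrest⟩ := h
    have ht := tree_spec k lo hl
    have hk2 : 0 < 2 ^ k := by positivity
    have hP : ((a * numT k lo : ℕ) : ℝ) / ((b * denT k lo : ℕ) : ℝ) = Pr (lo + 2 ^ k) := by
      push_cast
      rw [mul_div_mul_comm, ht.2, hab]
      unfold Pr
      rw [Finset.prod_Ico_consecutive _ (by omega) (by omega)]
    have hb2 : 0 < b * denT k lo := Nat.mul_pos hb ht.1
    have hr := ih (lo + 2 ^ k) _ _ (by omega) hb2 hP hrest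
    refine ⟨fun n h1 h2 => ?_, hr.2⟩
    rcases Nat.lt_or_ge n (lo + 2 ^ k) with h3 | h3
    · have hlt' : (a * numT k lo) * (256 * 10 ^ 10) ^ 2 <
          (b * denT k lo) * (lg (lo ^ 256) * 6931471803) ^ 2 := by
        simpa [Nat.blt, Nat.ble_eq] using hlt
      set a' := a * numT k lo
      set b' := b * denT k lo
      have hb' : (0 : ℝ) < b' := by exact_mod_cast hb2
      have hlt2 : (a' : ℝ) * (256 * 10 ^ 10) ^ 2 <
          b' * ((lg (lo ^ 256) : ℝ) * 6931471803) ^ 2 := by exact_mod_cast hlt'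
      have hlog := log2_le lo 256 (by omega)
      have g2 := Real.log_two_gt_d9
      have hd : (0 : ℝ) ≤ (lg (lo ^ 256) : ℝ) := by positivity
      have h4 : (lg (lo ^ 256) : ℝ) * 6931471803 ≤ 256 * 10 ^ 10 * Real.log lo := by
        push_cast at hlog
        nlinarith
      have h5 : ((lg (lo ^ 256) : ℝ) * 6931471803) ^ 2 ≤
          (256 * 10 ^ 10 * Real.log lo) ^ 2 := by gcongr
      have h6 : (a' : ℝ) / b' < Real.log lo ^ 2 := by
        rw [div_lt_iff₀ hb']
        have := mul_le_mul_of_nonneg_left h5 hb'.le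
        have h7 : (256 * 10 ^ 10 : ℝ) ^ 2 * a' < (256 * 10 ^ 10 : ℝ) ^ 2 * (Real.log lo ^ 2 * b') := by
          calc _ = (a' : ℝ) * (256 * 10 ^ 10) ^ 2 := by ring
            _ < _ := hlt2
            _ ≤ _ := this
            _ = _ := by ring
        exact lt_of_mul_lt_mul_left h7 (by positivity)
      have h8 : Real.log lo ≤ Real.log n :=
        Real.log_le_log (by exact_mod_cast (by omega : 0 < lo)) (by exact_mod_cast h1)
      have h9 : 0 ≤ Real.log lo := Real.log_natCast_nonneg lo
      calc Pr (n + 1) ≤ Pr (lo + 2 ^ k) := Pr_mono (by omega)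
        _ = a' / b' := hP.symm
        _ < Real.log lo ^ 2 := h6
        _ ≤ Real.log n ^ 2 := by gcongr
    · exact hr.1 n h3 h2

theorem chk_val : chk [2, 2, 2, 2, 2, 2, 2, 3, 3, 3, 3, 4, 4, 4, 4, 5, 5, 5, 6, 6, 6, 7, 7, 7,
    8, 8, 9, 9, 10, 10, 11, 11, 12, 11, 10, 9, 7, 5, 3, 2, 1, 0] 53
    (numT 5 0 * numT 4 32 * numT 2 48 * numT 0 52)
    (denT 5 0 * denT 4 32 * denT 2 48 * denT 0 52) = true := by decide +kernel

theorem small_range :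
    (∀ n, 53 ≤ n → n < 16384 → Pr (n + 1) < Real.log n ^ 2) ∧ Pr 16384 ≤ 85.82 := by
  have t1 := tree_spec 5 0 (by norm_num)
  have t2 := tree_spec 4 32 (by norm_num)
  have t3 := tree_spec 2 48 (by norm_num)
  have t4 := tree_spec 0 52 (by norm_num)
  refine chk_spec _ 53 _ _ le_rfl ?_ ?_ chk_val
  · have := t1.1; have := t2.1; have := t3.1; have := t4.1
    positivity
  · push_cast
    rw [mul_div_mul_comm, mul_div_mul_comm, mul_div_mul_comm, t1.2, t2.2, t3.2, t4.2]
    unfold Pr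
    norm_num only
    rw [Finset.prod_Ico_consecutive _ (by omega) (by omega),
      Finset.prod_Ico_consecutive _ (by omega) (by omega),
      Finset.prod_Ico_consecutive _ (by omega) (by omega)]

theorem large_range_aux (N M : ℕ) (hN16 : 16384 ≤ N) (hM : N ≤ M) (hB : 9.125 ≤ B N)
    (hN : Real.log N = 14 * Real.log 2) (hf : fac N = 1) (h5 : Pr N ≤ 85.82) :
    Pr (M + 1) < Real.log M ^ 2 := by
  have g2 := Real.log_two_gt_d9
  have g2' := Real.log_two_lt_d9
  set S := ∑ k ∈ Ioc N M, vonMangoldt k / k * (1 / Real.log k) with hS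
  have h1 : S ≤ _ := recip_sum_le N M hN16 hM 0.382 (by rw [hN]; nlinarith)
  have h2 : Pr (M + 1) ≤ Pr N * Real.exp (2 * S) := by
    have e : Pr (M + 1) = Pr N * ∏ k ∈ Ioc N M, fac k := by
      unfold Pr
      rw [← Finset.prod_Ico_consecutive _ (Nat.zero_le N) (by omega : N ≤ M + 1),
        Finset.prod_eq_prod_Ico_succ_bot (by omega : N < M + 1), hf, one_mul]
      congr 2
      ext k; simp only [Finset.mem_Ico, Finset.mem_Ioc]; omega
    have hP0 : 0 ≤ Pr N := Finset.prod_nonneg fun k _ => by linarith [one_le_fac k]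
    rw [e, hS, Finset.mul_sum, Real.exp_sum]
    gcongr with k hk
    · intro k _; linarith [one_le_fac k]
    · simp only [Finset.mem_Ioc] at hk
      have hL : 0 ≤ vonMangoldt k := ArithmeticFunction.vonMangoldt_nonneg
      have hlk : 0 < Real.log k := Real.log_pos (by exact_mod_cast (by omega : 1 < k))
      unfold fac
      split_ifs with hp
      · rw [ArithmeticFunction.vonMangoldt_apply_prime hp]
        have : 2 * (Real.log k / k * (1 / Real.log k)) = 2 / (k : ℝ) := by
          field_simp
        rw [this]
        linarith [Real.add_one_le_exp (2 / (k : ℝ))]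
      · rw [← Real.exp_zero]; gcongr; positivity
  have hMl : Real.log N ≤ Real.log M :=
    Real.log_le_log (by exact_mod_cast (by omega : 0 < N)) (by exact_mod_cast hM)
  rw [hN] at h1 hMl
  have hlp : 0 < Real.log M := by linarith
  have hl2 : 0 < 14 * Real.log 2 := by linarith
  have h3 : Real.exp (2 * S) ≤ Real.exp 0.0788 * (Real.log M / (14 * Real.log 2)) ^ 2 := by
    have hx : (Real.log M / (14 * Real.log 2)) ^ 2 =
        Real.exp (2 * (Real.log (Real.log M) - Real.log (14 * Real.log 2))) := by
      rw [← Real.log_div hlp.ne' hl2.ne', two_mul, Real.exp_add, Real.exp_log (by positivity), sq]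
    rw [hx, ← Real.exp_add]
    gcongr
    have : 0.382 * (1 / (14 * Real.log 2)) ≤ 0.0394 := by
      rw [mul_one_div, div_le_iff₀ hl2]; linarith
    linarith
  have h4 : Real.exp 0.0788 ≤ 1.0856 := by
    have h := Real.add_one_le_exp (-0.0788 : ℝ)
    rw [Real.exp_neg] at h
    have hp := Real.exp_pos 0.0788
    rw [le_inv_comm₀ (by norm_num) hp] at h
    refine h.trans (by norm_num)
  have hq : 0 < (Real.log M / (14 * Real.log 2)) ^ 2 := by positivity
  calc Pr (M + 1) ≤ Pr N * Real.exp (2 * S) := h2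
    _ ≤ 85.82 * (1.0856 * (Real.log M / (14 * Real.log 2)) ^ 2) := by
      gcongr
      exact h3.trans (by gcongr)
    _ = (85.82 * 1.0856) * (Real.log M / (14 * Real.log 2)) ^ 2 := by ring
    _ < (14 * Real.log 2) ^ 2 * (Real.log M / (14 * Real.log 2)) ^ 2 := by
      apply mul_lt_mul_of_pos_right _ hq
      nlinarith
    _ = Real.log M ^ 2 := by rw [← mul_pow, mul_div_cancel₀ _ hl2.ne']

theorem large_range (M : ℕ) (hM : 16384 ≤ M) : Pr (M + 1) < Real.log M ^ 2 := by
  refine large_range_aux 16384 M le_rfl hM B_lower ?_ ?_ small_range.2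
  · rw [show ((16384 : ℕ) : ℝ) = 2 ^ 14 by norm_num, Real.log_pow]; norm_num
  · unfold fac; rw [if_neg (by norm_num)]

end PrimeProd

theorem prod_one_add_two_div_lt (y : ℝ) (hy : 53 ≤ y) :
    ∏ p ∈ (Finset.Iic ⌊y⌋₊).filter Nat.Prime, (1 + 2 / (p : ℝ)) < (Real.log y) ^ 2 := by
  have h53 : 53 ≤ ⌊y⌋₊ := Nat.le_floor (by exact_mod_cast hy)
  have e : ∏ p ∈ (Finset.Iic ⌊y⌋₊).filter Nat.Prime, (1 + 2 / (p : ℝ)) =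
      PrimeProd.Pr (⌊y⌋₊ + 1) := by
    rw [Finset.prod_filter, PrimeProd.Pr]
    apply Finset.prod_congr
    · ext k; simp only [Finset.mem_Iic, Finset.mem_Ico]; omega
    · intro k _; rfl
  rw [e]
  have h1 : PrimeProd.Pr (⌊y⌋₊ + 1) < Real.log ⌊y⌋₊ ^ 2 := by
    rcases Nat.lt_or_ge ⌊y⌋₊ 16384 with h | h
    · exact PrimeProd.small_range.1 _ h53 h
    · exact PrimeProd.large_range _ h
  refine h1.trans_le ?_
  have h2 : Real.log ⌊y⌋₊ ≤ Real.log y :=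
    Real.log_le_log (by exact_mod_cast (by omega : 0 < ⌊y⌋₊)) (Nat.floor_le (by linarith))
  have h3 : 0 ≤ Real.log ⌊y⌋₊ := Real.log_natCast_nonneg _
  gcongr
end

section
/- Let $y \ge 53$ and let $P$ be a squarefree positive integer all of whose prime factors are $\le y$. Then for any real $D \ge 1$, $\sum_{d \mid P,\, d < D} \tau_3(d) < D (\log y)^2 \prod_{p \le y,\, p \nmid P} (1 + 2/p)^{-1}$, where $\tau_3(d)$ is the number of ordered triples $(a,b,c)$ of positive integers with $abc = d$, and the last product is over primes $p \le y$ not dividing $P$. -/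
open Finset
open scoped Classical

/-- `tau3 d` is the number of ordered triples `(a, b, c)` of positive integers with `a*b*c = d`. -/
def tau3 (d : ℕ) : ℕ :=
  ((Finset.Icc 1 d ×ˢ Finset.Icc 1 d ×ˢ Finset.Icc 1 d).filter
    (fun t : ℕ × ℕ × ℕ => t.1 * t.2.1 * t.2.2 = d)).card

namespace T3

/-- The primes below 256. -/
def smallP : List ℕ := [2, 3, 5, 7, 11, 13, 17, 19, 23, 29, 31, 37, 41, 43, 47, 53, 59, 61, 67,
  71, 73, 79, 83, 89, 97, 101, 103, 107, 109, 113, 127, 131, 137, 139, 149, 151, 157, 163, 167,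
  173, 179, 181, 191, 193, 197, 199, 211, 223, 227, 229, 233, 239, 241, 251]

def elemP (n : ℕ) : List ℕ → Bool
  | [] => false
  | p :: l => cond (Nat.beq n p) true (elemP n l)

/-- gcd with the product of the primes below 256. -/
def gQ (n : ℕ) : ℕ := Nat.gcd n (nat_lit 64266330917908644872330635228106713310880186591609208114244758680898150367880703152525200743234420230)

def isP (n : ℕ) : Bool := cond (Nat.beq (gQ n) (nat_lit 1)) (Nat.ble (nat_lit 2) n)
  (cond (Nat.ble n (nat_lit 256)) (elemP n smallP) false)

def leaf (a : ℕ) : ℕ :=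
  cond (isP a) (Nat.succ (Nat.div (Nat.mul (nat_lit 1000000000000000) (Nat.add a (nat_lit 2))) a))
    (nat_lit 1000000000000000)

/-- multiplication of fixed point numbers, rounding up -/
def fmul (a b : ℕ) : ℕ := Nat.succ (Nat.div (Nat.mul a b) (nat_lit 1000000000000000))

def prodUB (k : ℕ) : ℕ → ℕ :=
  Nat.rec leaf (fun k ih a => fmul (ih a) (ih (Nat.add a (Nat.pow (nat_lit 2) k)))) k

/-- A lower bound for the binary logarithm, by binary search. -/
def lgAux (m k : ℕ) : ℕ → ℕ :=
  Nat.rec (fun acc => acc)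
    (fun k ih acc => cond (Nat.ble (Nat.pow (nat_lit 2) (Nat.add acc (Nat.pow (nat_lit 2) k))) m)
      (ih (Nat.add acc (Nat.pow (nat_lit 2) k))) (ih acc)) k

def lg (m : ℕ) : ℕ := lgAux m (nat_lit 13) (nat_lit 0)

def test (a b : ℕ) : Bool :=
  Nat.ble (Nat.succ (Nat.mul b (nat_lit 65536000000000000)))
   (Nat.mul (nat_lit 1000000000000000)
     (Nat.pow (Nat.mul (lg (Nat.pow a (nat_lit 256))) (nat_lit 693147)) (nat_lit 2)))

def chk (k : ℕ) : ℕ → ℕ → Bool :=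
  Nat.rec (fun a acc => test a (fmul acc (leaf a)))
    (fun k ih a acc => cond (test a (fmul acc (prodUB (Nat.succ k) a))) true
      (cond (ih a acc) (ih (Nat.add a (Nat.pow (nat_lit 2) k)) (fmul acc (prodUB k a))) false)) k

def wt (g n : ℕ) : ℕ :=
  Nat.div (Nat.mul (lg (Nat.pow g (nat_lit 256))) (nat_lit 1000000000)) n

def fS (n : ℕ) : ℕ :=
  cond (Nat.beq (gQ n) (nat_lit 1)) (wt n n)
    (cond (Nat.beq (Nat.mod (Nat.pow (gQ n) (nat_lit 16)) n) (nat_lit 0))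
      (cond (Nat.ble (gQ n) (nat_lit 256))
        (cond (elemP (gQ n) smallP) (wt (gQ n) n) (nat_lit 0)) (nat_lit 0)) (nat_lit 0))

def sumLB (k : ℕ) : ℕ → ℕ :=
  Nat.rec fS (fun k ih a => Nat.add (ih a) (ih (Nat.add a (Nat.pow (nat_lit 2) k)))) k

theorem prodUB_val : Nat.ble (prodUB 15 1) 98410000000000000 = true := by decide +kernel

theorem sumLB_val : Nat.ble 3625100000000 (sumLB 15 1) = true := by decide +kernel

theorem acc_val : Nat.ble (fmul (fmul (prodUB 5 1) (prodUB 4 33)) (prodUB 2 49)) 15077803335622000 = true := by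
  decide +kernel

theorem chk_val : chk 15 53 15077803335622000 = true := by decide +kernel


theorem prodUB_zero (a : ℕ) : prodUB 0 a = leaf a := rfl
theorem prodUB_succ (k a : ℕ) : prodUB (k + 1) a = fmul (prodUB k a) (prodUB k (a + 2 ^ k)) := rfl
theorem chk_zero (a acc : ℕ) : chk 0 a acc = test a (fmul acc (prodUB 0 a)) := rfl
theorem chk_succ (k a acc : ℕ) : chk (k + 1) a acc =
  cond (test a (fmul acc (prodUB (k + 1) a))) true
      (cond (chk k a acc) (chk k (a + 2 ^ k) (fmul acc (prodUB k a))) false) := rfl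
theorem sumLB_succ (k a : ℕ) : sumLB (k + 1) a = sumLB k a + sumLB k (a + 2 ^ k) := rfl

theorem lgAux_spec (m k : ℕ) : ∀ acc, 2 ^ acc ≤ m → 2 ^ lgAux m k acc ≤ m := by
  induction k with
  | zero => intro acc h; exact h
  | succ k ih =>
    intro acc h
    show 2 ^ (cond (Nat.ble (2 ^ (acc + 2 ^ k)) m) (lgAux m k (acc + 2 ^ k)) (lgAux m k acc)) ≤ m
    cases h2 : Nat.ble (2 ^ (acc + 2 ^ k)) m
    · exact ih _ h
    · exact ih _ (Nat.le_of_ble_eq_true h2)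

theorem lg_pow_le (m : ℕ) (h : 1 ≤ m) : 2 ^ lg m ≤ m := by
  have := lgAux_spec m 13 0 (by simpa using h)
  exact this

theorem test_le (a b : ℕ) (h : test a b = true) :
    b * 65536000000000000 + 1 ≤ 1000000000000000 * (lg (a ^ 256) * 693147) ^ 2 :=
  Nat.le_of_ble_eq_true h

theorem wt_eq (g n : ℕ) : wt g n = (lg (g ^ 256) * 1000000000) / n := rfl

theorem sumLB_zero (a : ℕ) : sumLB 0 a = fS a := rfl

attribute [irreducible] lg prodUB sumLB chk wt test

theorem prodUB_val' : prodUB 15 1 ≤ 98410000000000000 := Nat.le_of_ble_eq_true prodUB_val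

theorem sumLB_val' : 3625100000000 ≤ sumLB 15 1 := Nat.le_of_ble_eq_true sumLB_val

theorem acc_val' : fmul (fmul (prodUB 5 1) (prodUB 4 33)) (prodUB 2 49) ≤ 15077803335622000 :=
  Nat.le_of_ble_eq_true acc_val


theorem elemP_iff (n : ℕ) (l : List ℕ) : elemP n l = true ↔ n ∈ l := by
  induction l with
  | nil => simp [elemP]
  | cons p l ih =>
    rw [elemP, List.mem_cons, ← ih]
    cases h : Nat.beq n p
    · have : n ≠ p := Nat.ne_of_beq_eq_false h
      simp [this]
    · have : n = p := Nat.eq_of_beq_eq_true h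
      simp [this]

theorem smallP_prime : ∀ p ∈ smallP, p.Prime := by
  intro p hp
  simp only [smallP, List.mem_cons, List.not_mem_nil, or_false] at hp
  rcases hp with h|h|h|h|h|h|h|h|h|h|h|h|h|h|h|h|h|h|h|h|h|h|h|h|h|h|h|h|h|h|h|h|h|h|h|h|h|h|h|h|h|h|h|h|h|h|h|h|h|h|h|h|h|h <;>
  (subst h; norm_num)

theorem smallP_le : ∀ p ∈ smallP, p ≤ 256 := by decide +kernel

theorem smallP_cover : ∀ p < 257, p ∈ smallP ∨ p < 2 ∨
    ∃ q ∈ [2, 3, 5, 7, 11, 13], p % q = 0 ∧ q ≠ p := by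
  decide +kernel

theorem smallP_complete : ∀ p < 257, p.Prime → p ∈ smallP := by
  intro p hp hpp
  rcases smallP_cover p hp with h | h | ⟨q, hq, h1, h2⟩
  · exact h
  · exact absurd hpp.two_le (by omega)
  · rcases (Nat.dvd_prime hpp).1 (Nat.dvd_of_mod_eq_zero h1) with h | h
    · subst h
      simp at hq
    · exact absurd h h2

theorem gQ_eq (n : ℕ) : gQ n = Nat.gcd n smallP.prod := by
  have : smallP.prod = 64266330917908644872330635228106713310880186591609208114244758680898150367880703152525200743234420230 := by
    decide +kernel
  rw [this]; rfl

theorem isP_of_prime {n : ℕ} (hn : n.Prime) : isP n = true := by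
  have h2 : Nat.ble 2 n = true := Nat.ble_eq_true_of_le hn.two_le
  unfold isP
  cases h : Nat.beq (gQ n) 1
  · have hne : gQ n ≠ 1 := Nat.ne_of_beq_eq_false h
    rw [gQ_eq] at hne
    have hd : n ∣ smallP.prod := by
      by_contra hd
      exact hne ((Nat.Prime.coprime_iff_not_dvd hn).2 hd)
    obtain ⟨p, hp, hnp⟩ := (Prime.dvd_prod_iff hn.prime).1 hd
    have he : n = p := (Nat.prime_dvd_prime_iff_eq hn (smallP_prime p hp)).1 hnp
    subst he
    have h3 : Nat.ble n 256 = true := Nat.ble_eq_true_of_le (smallP_le n hp)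
    have h4 : elemP n smallP = true := (elemP_iff _ _).2 hp
    simp [h3, h4]
  · simpa using h2

theorem leaf_ge (a : ℕ) (h : 0 < a) : (1000000000000000 : ℝ) ≤ leaf a := by
  unfold leaf
  cases isP a
  · simp
  · have : 1000000000000000 * a ≤ 1000000000000000 * (a + 2) := by omega
    have h2 : 1000000000000000 ≤ 1000000000000000 * (a + 2) / a := by
      rw [Nat.le_div_iff_mul_le h]; omega
    have h3 : 1000000000000000 ≤ Nat.succ (1000000000000000 * (a + 2) / a) := by omega
    exact_mod_cast h3

theorem leaf_spec (a : ℕ) (h : a.Prime) : (1000000000000000 : ℝ) * (1 + 2 / a) ≤ leaf a := by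
  unfold leaf
  rw [isP_of_prime h]
  have ha : (0 : ℝ) < a := by exact_mod_cast h.pos
  have h2 : (1000000000000000 * (a + 2) : ℕ) < a * (1000000000000000 * (a + 2) / a + 1) := by
    have := Nat.lt_mul_div_succ (1000000000000000 * (a + 2)) h.pos
    simpa using this
  have h3 : ((1000000000000000 * (a + 2) : ℕ) : ℝ) < ((a * (1000000000000000 * (a + 2) / a + 1) : ℕ) : ℝ) := by
    exact_mod_cast h2
  show _ ≤ ((1000000000000000 * (a + 2) / a + 1 : ℕ) : ℝ)
  generalize 1000000000000000 * (a + 2) / a + 1 = q at h3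
  push_cast at h3
  have : (1000000000000000 : ℝ) * (1 + 2 / a) = 1000000000000000 * (a + 2) / a := by
    field_simp
  rw [this, div_le_iff₀ ha]
  nlinarith

theorem fmul_spec (a b : ℕ) : (a : ℝ) * b ≤ 1000000000000000 * fmul a b := by
  have h2 : a * b < 1000000000000000 * (a * b / 1000000000000000 + 1) :=
    Nat.lt_mul_div_succ (a * b) (by norm_num)
  have h3 : ((a * b : ℕ) : ℝ) < ((1000000000000000 * (a * b / 1000000000000000 + 1) : ℕ) : ℝ) := by
    exact_mod_cast h2
  show _ ≤ 1000000000000000 * ((a * b / 1000000000000000 + 1 : ℕ) : ℝ)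
  rw [Nat.cast_mul, Nat.cast_mul] at h3
  exact_mod_cast h3.le

/-- The product of `1 + 2/p` over the primes in `[a, b)`. -/
noncomputable def pp (a b : ℕ) : ℝ := ∏ p ∈ (Finset.Ico a b).filter Nat.Prime, (1 + 2 / (p : ℝ))

theorem pp_mul {a b c : ℕ} (h1 : a ≤ b) (h2 : b ≤ c) : pp a b * pp b c = pp a c := by
  unfold pp
  rw [Finset.prod_filter, Finset.prod_filter, Finset.prod_filter]
  exact Finset.prod_Ico_consecutive _ h1 h2

theorem one_le_pp (a b : ℕ) : 1 ≤ pp a b := by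
  unfold pp
  apply Finset.one_le_prod
  intro p _
  have : (0 : ℝ) ≤ 2 / p := by positivity
  linarith

theorem pp_succ (a : ℕ) : pp a (a + 1) = if a.Prime then 1 + 2 / (a : ℝ) else 1 := by
  unfold pp
  rw [Finset.prod_filter, Nat.Ico_succ_singleton, Finset.prod_singleton]

theorem prodUB_spec (k : ℕ) : ∀ a, 0 < a → 1000000000000000 * pp a (a + 2 ^ k) ≤ prodUB k a := by
  induction k with
  | zero =>
    intro a ha
    rw [pow_zero, pp_succ, prodUB_zero]
    split_ifs with h
    · exact leaf_spec a h
    · simpa using leaf_ge a ha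
  | succ k ih =>
    intro a ha
    have h1 := ih a ha
    have h2 := ih (a + 2 ^ k) (Nat.add_pos_left ha _)
    have h3 := fmul_spec (prodUB k a) (prodUB k (a + 2 ^ k))
    rw [prodUB_succ]
    have h4 : pp a (a + 2 ^ (k + 1)) = pp a (a + 2 ^ k) * pp (a + 2 ^ k) (a + 2 ^ k + 2 ^ k) := by
      rw [pp_mul (Nat.le_add_right _ _) (Nat.le_add_right _ _)]
      congr 1; ring
    rw [h4]
    have := one_le_pp a (a + 2 ^ k)
    have := one_le_pp (a + 2 ^ k) (a + 2 ^ k + 2 ^ k)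
    have h5 := mul_le_mul h1 h2 (by positivity) (by positivity)
    linarith

theorem lg_spec (a : ℕ) (h : 0 < a) : (lg (a ^ 256) : ℝ) * Real.log 2 ≤ 256 * Real.log a := by
  have h1 : 2 ^ lg (a ^ 256) ≤ a ^ 256 := lg_pow_le _ (Nat.one_le_pow _ _ h)
  have h2 : ((2 : ℝ) ^ lg (a ^ 256)) ≤ (a : ℝ) ^ 256 := by exact_mod_cast h1
  have h3 := Real.log_le_log (by positivity) h2
  rw [Real.log_pow, Real.log_pow] at h3
  exact_mod_cast h3

theorem test_spec (a b : ℕ) (ha : 0 < a) (h : test a b = true) :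
    (b : ℝ) < 1000000000000000 * Real.log a ^ 2 := by
  have h1 : b * 65536000000000000 + 1 ≤ 1000000000000000 * (lg (a ^ 256) * 693147) ^ 2 := test_le a b h
  have h2 : (b : ℝ) * 65536000000000000 + 1 ≤ 1000000000000000 * (lg (a ^ 256) * 693147) ^ 2 := by
    exact_mod_cast h1
  have h3 := lg_spec a ha
  have h4 := Real.log_two_gt_d9
  generalize lg (a ^ 256) = L at *
  have h5 : (L : ℝ) * 693147 ≤ 256000000 * Real.log a := by
    have : (0 : ℝ) ≤ L := by positivity
    nlinarith
  have h6 : ((L : ℝ) * 693147) ^ 2 ≤ (256000000 * Real.log a) ^ 2 := by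
    gcongr
  nlinarith


theorem pp_mono {a b c : ℕ} (h1 : a ≤ b) (h : b ≤ c) : pp a b ≤ pp a c := by
  rw [← pp_mul h1 h]
  have := one_le_pp b c
  have := one_le_pp a b
  nlinarith

theorem acc_step (k a acc : ℕ) (ha : 0 < a) (h : 1000000000000000 * pp 0 a ≤ acc) :
    1000000000000000 * pp 0 (a + 2 ^ k) ≤ fmul acc (prodUB k a) := by
  have h1 := prodUB_spec k a ha
  have h2 := fmul_spec acc (prodUB k a)
  rw [← pp_mul (Nat.zero_le a) (Nat.le_add_right a (2 ^ k))]
  have := one_le_pp 0 a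
  have := one_le_pp a (a + 2 ^ k)
  have h5 := mul_le_mul h h1 (by positivity) (by positivity)
  linarith

theorem chk_aux (k a acc : ℕ) (ha : 0 < a) (h : 1000000000000000 * pp 0 a ≤ acc)
    (ht : test a (fmul acc (prodUB k a)) = true) (n : ℕ) (h1 : a ≤ n) (h2 : n < a + 2 ^ k) :
    pp 0 (n + 1) < Real.log n ^ 2 := by
  have h3 := acc_step k a acc ha h
  have h4 := test_spec _ _ ha ht
  have h5 : pp 0 (n + 1) ≤ pp 0 (a + 2 ^ k) := pp_mono (Nat.zero_le _) h2
  have h6 : Real.log a ≤ Real.log n := Real.log_le_log (by exact_mod_cast ha) (by exact_mod_cast h1)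
  have h7 : 0 ≤ Real.log a := Real.log_natCast_nonneg a
  nlinarith

theorem chk_spec (k : ℕ) : ∀ a acc : ℕ, 0 < a → 1000000000000000 * pp 0 a ≤ acc →
    chk k a acc = true → ∀ n, a ≤ n → n < a + 2 ^ k → pp 0 (n + 1) < Real.log n ^ 2 := by
  induction k with
  | zero =>
    intro a acc ha h hc n h1 h2
    rw [chk_zero] at hc
    exact chk_aux 0 a acc ha h hc n h1 h2
  | succ k ih =>
    intro a acc ha h hc n h1 h2
    rw [chk_succ] at hc
    cases ht : test a (fmul acc (prodUB (k + 1) a))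
    · rw [ht] at hc
      simp only [cond_false] at hc
      cases hc1 : chk k a acc
      · simp [hc1] at hc
      · simp only [hc1, cond_true] at hc
        by_cases hn : n < a + 2 ^ k
        · exact ih a acc ha h hc1 n h1 hn
        · exact ih (a + 2 ^ k) _ (by omega) (acc_step k a acc ha h) hc n (by omega)
            (by rw [pow_succ] at h2; omega)
    · exact chk_aux (k + 1) a acc ha h ht n h1 h2

theorem pp_zero_one : pp 0 1 = 1 := by
  rw [pp_succ]; simp

theorem small_range (n : ℕ) (h1 : 53 ≤ n) (h2 : n < 53 + 2 ^ 15) : pp 0 (n + 1) < Real.log n ^ 2 := by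
  refine chk_spec 15 53 15077803335622000 (by norm_num) ?_ chk_val n h1 h2
  have e1 := prodUB_spec 5 1 (by norm_num)
  have e0 : 1000000000000000 * pp 0 (1 + 2 ^ 5) ≤ prodUB 5 1 := by
    rw [← pp_mul (b := 1) (by norm_num) (by norm_num), pp_zero_one]; linarith
  have e2 := acc_step 4 33 _ (by norm_num) e0
  have e3 := acc_step 2 49 _ (by norm_num) e2
  have e4 : ((fmul (fmul (prodUB 5 1) (prodUB 4 33)) (prodUB 2 49) : ℕ) : ℝ) ≤ (15077803335622000 : ℕ) := by
    exact_mod_cast acc_val'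
  exact e3.trans e4

theorem pp_N : pp 0 32769 ≤ 98.41 := by
  have e1 := prodUB_spec 15 1 (by norm_num)
  have e2 : ((prodUB 15 1 : ℕ) : ℝ) ≤ (98410000000000000 : ℕ) := by
    exact_mod_cast prodUB_val'
  rw [← pp_mul (b := 1) (by norm_num) (by norm_num), pp_zero_one]
  have e3 : (1 : ℕ) + 2 ^ 15 = 32769 := by norm_num
  rw [e3] at e1
  rw [Nat.cast_ofNat] at e2
  linarith

open ArithmeticFunction in
theorem wt_spec (g n : ℕ) (hg : 0 < g) (hn : 0 < n) :
    (wt g n : ℝ) * Real.log 2 ≤ 256000000000 * (Real.log g / n) := by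
  have h1 : wt g n = (lg (g ^ 256) * 1000000000) / n := wt_eq g n
  have hn' : (0 : ℝ) < n := by exact_mod_cast hn
  have h2 : (wt g n : ℝ) ≤ (lg (g ^ 256) * 1000000000 : ℕ) / (n : ℝ) := by
    rw [h1]; exact Nat.cast_div_le
  have h3 := lg_spec g hg
  have h4 : 0 < Real.log 2 := Real.log_pos (by norm_num)
  calc (wt g n : ℝ) * Real.log 2 ≤ (lg (g ^ 256) * 1000000000 : ℕ) / (n : ℝ) * Real.log 2 := by gcongr
    _ = (lg (g ^ 256) * Real.log 2) * 1000000000 / n := by push_cast; ring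
    _ ≤ (256 * Real.log g) * 1000000000 / n := by gcongr
    _ = _ := by ring

open ArithmeticFunction in
theorem fS_spec (n : ℕ) (hn : 0 < n) (hn2 : n < 66000) :
    (fS n : ℝ) * Real.log 2 ≤ 256000000000 * (vonMangoldt n / n) := by
  have hnn : 0 ≤ 256000000000 * (vonMangoldt n / (n : ℝ)) := by
    have := @vonMangoldt_nonneg n
    positivity
  unfold fS
  cases h1 : Nat.beq (gQ n) 1
  · simp only [cond_false]
    cases h2 : Nat.beq (Nat.mod (Nat.pow (gQ n) 16) n) 0
    · simpa using hnn
    · cases h3 : Nat.ble (gQ n) 256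
      · simpa using hnn
      · cases h4 : elemP (gQ n) smallP
        · simpa using hnn
        · simp only [cond_true]
          have hp : (gQ n).Prime := smallP_prime _ ((elemP_iff _ _).1 h4)
          have hd : n ∣ (gQ n) ^ 16 := Nat.dvd_of_mod_eq_zero (Nat.eq_of_beq_eq_true h2)
          obtain ⟨k, hk, hk2⟩ := (Nat.dvd_prime_pow hp).1 hd
          have hgn : gQ n ∣ n := by rw [gQ_eq]; exact Nat.gcd_dvd_left _ _
          have hk0 : k ≠ 0 := by
            rintro rfl
            rw [pow_zero] at hk2
            exact hp.one_lt.ne' (Nat.dvd_one.1 (hgn.trans (dvd_of_eq hk2)))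
          have hL : vonMangoldt n = Real.log (gQ n) := by
            conv_lhs => rw [hk2]
            rw [vonMangoldt_apply_pow hk0, vonMangoldt_apply_prime hp]
          rw [hL]
          exact wt_spec _ _ hp.pos hn
  · simp only [cond_true]
    have hg : gQ n = 1 := Nat.eq_of_beq_eq_true h1
    rw [gQ_eq] at hg
    have hL : vonMangoldt n = Real.log n := by
      by_cases h : n = 1
      · simp [h]
      · apply vonMangoldt_apply_prime
        by_contra hnp
        have hm := Nat.minFac_sq_le_self hn hnp
        have hmp := Nat.minFac_prime h
        have hlt : n.minFac < 257 := by nlinarith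
        have hmem := smallP_complete _ hlt hmp
        have hd : n.minFac ∣ Nat.gcd n smallP.prod :=
          Nat.dvd_gcd (Nat.minFac_dvd n) (List.dvd_prod hmem)
        rw [hg] at hd
        exact hmp.one_lt.ne' (Nat.dvd_one.1 hd)
    rw [hL]
    exact wt_spec _ _ hn hn


open ArithmeticFunction in
theorem sumLB_spec (k : ℕ) : ∀ a, 0 < a → a + 2 ^ k ≤ 66000 →
    (sumLB k a : ℝ) * Real.log 2 ≤ 256000000000 * ∑ n ∈ Finset.Ico a (a + 2 ^ k), vonMangoldt n / (n : ℝ) := by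
  induction k with
  | zero =>
    intro a ha h
    rw [pow_zero, Nat.Ico_succ_singleton, Finset.sum_singleton]
    rw [sumLB_zero]
    exact fS_spec a ha (by omega)
  | succ k ih =>
    intro a ha h
    rw [pow_succ] at h
    have h1 := ih a ha (by omega)
    have h2 := ih (a + 2 ^ k) (by omega) (by omega)
    have h3 := Finset.sum_Ico_consecutive (fun n : ℕ => vonMangoldt n / (n : ℝ))
      (Nat.le_add_right a (2 ^ k)) (Nat.le_add_right (a + 2 ^ k) (2 ^ k))
    have h4 : a + 2 ^ (k + 1) = a + 2 ^ k + 2 ^ k := by ring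
    rw [h4, ← h3, sumLB_succ]
    push_cast
    linarith

/-- `∑_{n ≤ N} Λ(n)/n` -/
noncomputable def SS (N : ℕ) : ℝ := ∑ n ∈ Finset.Ioc 0 N, ArithmeticFunction.vonMangoldt n / (n : ℝ)

theorem SS_N : 9.815 ≤ SS 32768 := by
  have h1 := sumLB_spec 15 1 (by norm_num) (by norm_num)
  have h2 : ((3625100000000 : ℕ) : ℝ) ≤ (sumLB 15 1 : ℕ) := by
    exact_mod_cast sumLB_val'
  have h3 : Finset.Ico 1 (1 + 2 ^ 15) = Finset.Ioc 0 32768 := by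
    ext x; simp only [Finset.mem_Ico, Finset.mem_Ioc]; omega
  rw [h3] at h1
  have h4 := Real.log_two_gt_d9
  unfold SS
  rw [Nat.cast_ofNat] at h2
  nlinarith

open ArithmeticFunction

/-- Chebyshev's function at naturals. -/
noncomputable def ps (m : ℕ) : ℝ := ∑ d ∈ Finset.Ioc 0 m, vonMangoldt d

theorem log_factorial_eq (n : ℕ) :
    Real.log (n.factorial) = ∑ d ∈ Finset.Ioc 0 n, vonMangoldt d * ((n / d : ℕ) : ℝ) := by
  have h := sum_Ioc_mul_zeta_eq_sum (vonMangoldt) n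
  rw [← h, vonMangoldt_mul_zeta]
  induction n with
  | zero => simp
  | succ n ih =>
    rw [Nat.factorial_succ, Finset.sum_Ioc_succ_top (Nat.zero_le n), ← ih (sum_Ioc_mul_zeta_eq_sum _ n)]
    push_cast
    rw [Real.log_mul (by positivity) (by positivity), ArithmeticFunction.log_apply]
    push_cast
    ring

theorem log_factorial_div (n k : ℕ) :
    Real.log ((n / k).factorial) = ∑ d ∈ Finset.Ioc 0 n, vonMangoldt d * ((n / d / k : ℕ) : ℝ) := by
  rw [log_factorial_eq]
  have hsub : Finset.Ioc 0 (n / k) ⊆ Finset.Ioc 0 n :=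
    Finset.Ioc_subset_Ioc_right (Nat.div_le_self n k)
  have h2 : ∀ d, n / k / d = n / d / k := fun d => by
    rw [Nat.div_div_eq_div_mul, Nat.div_div_eq_div_mul, mul_comm]
  rw [← Finset.sum_subset hsub]
  · simp only [h2]
  · intro d hd hd2
    have h3 : n / k / d = 0 := by
      apply Nat.div_eq_of_lt
      simp only [Finset.mem_Ioc] at hd hd2
      omega
    rw [← h2, h3]; simp

/-- Chebyshev's combination. -/
noncomputable def W (n : ℕ) : ℝ :=
  Real.log (n.factorial) - Real.log ((n / 2).factorial) - Real.log ((n / 3).factorial)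
    - Real.log ((n / 5).factorial) + Real.log ((n / 30).factorial)

theorem W_eq (n : ℕ) : W n = ∑ d ∈ Finset.Ioc 0 n, vonMangoldt d *
    (((n / d : ℕ) : ℝ) - ((n / d / 2 : ℕ) : ℝ) - ((n / d / 3 : ℕ) : ℝ) - ((n / d / 5 : ℕ) : ℝ)
      + ((n / d / 30 : ℕ) : ℝ)) := by
  unfold W
  rw [log_factorial_div, log_factorial_div, log_factorial_div, log_factorial_div, log_factorial_eq]
  rw [← Finset.sum_sub_distrib, ← Finset.sum_sub_distrib, ← Finset.sum_sub_distrib,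
    ← Finset.sum_add_distrib]
  apply Finset.sum_congr rfl
  intro d _
  ring

theorem W_le (n : ℕ) : W n ≤ ps n := by
  rw [W_eq, ps]
  apply Finset.sum_le_sum
  intro d _
  have h : n / d + n / d / 30 ≤ 1 + n / d / 2 + n / d / 3 + n / d / 5 := by omega
  have h2 : ((n / d : ℕ) : ℝ) + ((n / d / 30 : ℕ) : ℝ) ≤ 1 + ((n / d / 2 : ℕ) : ℝ)
    + ((n / d / 3 : ℕ) : ℝ) + ((n / d / 5 : ℕ) : ℝ) := by exact_mod_cast h
  have := @vonMangoldt_nonneg d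
  calc _ ≤ vonMangoldt d * 1 := by gcongr; linarith
    _ = _ := mul_one _

theorem le_W (n : ℕ) : ps n ≤ ps (n / 6) + W n := by
  have hsub : Finset.Ioc 0 (n / 6) ⊆ Finset.Ioc 0 n :=
    Finset.Ioc_subset_Ioc_right (Nat.div_le_self n 6)
  have e : ps (n / 6) = ∑ d ∈ Finset.Ioc 0 n, if d ≤ n / 6 then vonMangoldt d else 0 := by
    rw [ps, ← Finset.sum_subset hsub (f := fun d => if d ≤ n / 6 then vonMangoldt d else 0)]
    · apply Finset.sum_congr rfl
      intro d hd
      rw [if_pos (Finset.mem_Ioc.1 hd).2]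
    · intro d hd hd2
      simp only [Finset.mem_Ioc] at hd hd2
      rw [if_neg (by omega)]
  rw [e, W_eq, ps, ← Finset.sum_add_distrib]
  apply Finset.sum_le_sum
  intro d hd
  have hd' := Finset.mem_Ioc.1 hd
  have := @vonMangoldt_nonneg d
  have h : n / d / 2 + n / d / 3 + n / d / 5 ≤ n / d + n / d / 30 := by omega
  have h2 : ((n / d / 2 : ℕ) : ℝ) + ((n / d / 3 : ℕ) : ℝ) + ((n / d / 5 : ℕ) : ℝ)
    ≤ ((n / d : ℕ) : ℝ) + ((n / d / 30 : ℕ) : ℝ) := by exact_mod_cast h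
  by_cases hc : d ≤ n / 6
  · rw [if_pos hc]
    have := mul_nonneg this (sub_nonneg.2 h2)
    nlinarith
  · rw [if_neg hc]
    have h3 : n / d < 6 := by
      rw [Nat.div_lt_iff_lt_mul hd'.1]
      omega
    have h4 : 1 ≤ n / d := (Nat.one_le_div_iff hd'.1).2 hd'.2
    have h5 : n / d / 2 + n / d / 3 + n / d / 5 + 1 = n / d + n / d / 30 := by omega
    have h6 : ((n / d / 2 : ℕ) : ℝ) + ((n / d / 3 : ℕ) : ℝ) + ((n / d / 5 : ℕ) : ℝ) + 1
      = ((n / d : ℕ) : ℝ) + ((n / d / 30 : ℕ) : ℝ) := by exact_mod_cast h5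
    have h7 : ((n / d : ℕ) : ℝ) - ((n / d / 2 : ℕ) : ℝ) - ((n / d / 3 : ℕ) : ℝ) - ((n / d / 5 : ℕ) : ℝ)
      + ((n / d / 30 : ℕ) : ℝ) = 1 := by linarith
    rw [h7]; linarith

theorem log_fact_le (m : ℕ) (hm : 1 ≤ m) :
    Real.log m.factorial ≤ m * Real.log m - m + Real.log m / 2 + 1 := by
  obtain ⟨k, rfl⟩ : ∃ k, m = k + 1 := ⟨m - 1, by omega⟩
  have h := Stirling.log_stirlingSeq'_antitone (Nat.zero_le k)
  simp only [Function.comp, Nat.succ_eq_add_one, zero_add, Stirling.stirlingSeq_one] at h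
  have e : Real.log (Real.exp 1 / √2) = 1 - Real.log 2 / 2 := by
    rw [Real.log_div (by positivity) (by positivity), Real.log_exp, Real.log_sqrt (by norm_num)]
  rw [Stirling.log_stirlingSeq_formula, e, Real.log_mul (by positivity) (by positivity),
    Real.log_div (by positivity) (by positivity), Real.log_exp] at h
  linarith

theorem le_log_fact (m : ℕ) (hm : 1 ≤ m) :
    m * Real.log m - m ≤ Real.log m.factorial := by
  have h := Stirling.le_log_factorial_stirling (n := m) (by omega)
  have h1 : 0 ≤ Real.log m := Real.log_natCast_nonneg m
  have h2 : 0 ≤ Real.log (2 * Real.pi) := Real.log_nonneg (by linarith [Real.pi_gt_three])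
  linarith

theorem stir_upper (n k : ℕ) (hk : 1 ≤ k) (hn : k ≤ n) :
    Real.log (n / k).factorial ≤ (n / k : ℝ) * (Real.log n - Real.log k) - n / k
      + (Real.log n - Real.log k) / 2 + 1 := by
  have hk0 : (0 : ℝ) < k := by exact_mod_cast hk
  have hn0 : (0 : ℝ) < n := by exact_mod_cast (by omega : 0 < n)
  rw [← Real.log_div hn0.ne' hk0.ne']
  have hm1 : 1 ≤ n / k := (Nat.one_le_div_iff hk).2 hn
  have hmx : ((n / k : ℕ) : ℝ) ≤ (n : ℝ) / k := Nat.cast_div_le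
  have h := log_fact_le (n / k) hm1
  generalize n / k = m at *
  generalize (n : ℝ) / k = x at *
  have hm : (1 : ℝ) ≤ m := by exact_mod_cast hm1
  have hx : 0 < x := by linarith
  have h1 := Real.one_sub_inv_le_log_of_pos (x := x / m) (by positivity)
  rw [Real.log_div (by positivity) (by positivity)] at h1
  have h2 : x * (1 - (x / m)⁻¹) = x - m := by field_simp
  have h3 := mul_le_mul_of_nonneg_left h1 hx.le
  have h4 : 0 ≤ Real.log m := Real.log_nonneg hm
  have h5 : Real.log m ≤ Real.log x := Real.log_le_log (by linarith) hmx
  have h6 : 0 ≤ (x - m) * Real.log m := mul_nonneg (by linarith) h4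
  nlinarith

theorem stir_lower (n k : ℕ) (hk : 1 ≤ k) (hn : k ≤ n) :
    (n / k : ℝ) * (Real.log n - Real.log k) - n / k - (Real.log n - Real.log k) ≤
    Real.log (n / k).factorial := by
  have hk0 : (0 : ℝ) < k := by exact_mod_cast hk
  have hn0 : (0 : ℝ) < n := by exact_mod_cast (by omega : 0 < n)
  rw [← Real.log_div hn0.ne' hk0.ne']
  have hm1 : 1 ≤ n / k := (Nat.one_le_div_iff hk).2 hn
  have hmx : ((n / k : ℕ) : ℝ) ≤ (n : ℝ) / k := Nat.cast_div_le
  have hmx2 : (n : ℝ) / k ≤ ((n / k : ℕ) : ℝ) + 1 := by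
    rw [← Nat.floor_div_eq_div (K := ℝ)]
    exact (Nat.lt_floor_add_one _).le
  have h := le_log_fact (n / k) hm1
  generalize n / k = m at *
  generalize (n : ℝ) / k = x at *
  have hm : (1 : ℝ) ≤ m := by exact_mod_cast hm1
  have hx : 0 < x := by linarith
  have h1 := Real.log_le_sub_one_of_pos (x := x / m) (by positivity)
  rw [Real.log_div (by positivity) (by positivity)] at h1
  have h2 : m * (x / m - 1) = x - m := by field_simp
  have h3 := mul_le_mul_of_nonneg_left h1 (by linarith : (0 : ℝ) ≤ m)
  have h5 : 0 ≤ Real.log x := Real.log_nonneg (by linarith)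
  have h6 : (x - m) * Real.log x ≤ 1 * Real.log x := mul_le_mul_of_nonneg_right (by linarith) h5
  nlinarith

noncomputable def AA : ℝ := Real.log 2 / 2 + Real.log 3 / 3 + Real.log 5 / 5 -
  (Real.log 2 + Real.log 3 + Real.log 5) / 30

theorem log_30 : Real.log 30 = Real.log 2 + Real.log 3 + Real.log 5 := by
  rw [← Real.log_mul (by norm_num) (by norm_num), ← Real.log_mul (by norm_num) (by norm_num)]
  norm_num

theorem log3_bounds : 1.0985 < Real.log 3 ∧ Real.log 3 < 1.0987 := by
  have h1 := Real.log_three_gt_d9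
  have h2 := Real.log_three_lt_d9
  constructor <;> linarith

theorem log5_bounds : 1.609 < Real.log 5 ∧ Real.log 5 < 1.6096 := by
  have h1 := Real.log_two_gt_d9
  have h2 := Real.log_two_lt_d9
  constructor
  · have h : Real.log ((2:ℝ) ^ 65) < Real.log (5 ^ 28) := Real.log_lt_log (by norm_num) (by norm_num)
    rw [Real.log_pow, Real.log_pow] at h
    push_cast at h; linarith
  · have h : Real.log (5 ^ 59) < Real.log ((2:ℝ) ^ 137) := Real.log_lt_log (by norm_num) (by norm_num)
    rw [Real.log_pow, Real.log_pow] at h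
    push_cast at h; linarith

theorem AA_bounds : 0.921 < AA ∧ AA < 0.9215 := by
  have h1 := Real.log_two_gt_d9
  have h2 := Real.log_two_lt_d9
  obtain ⟨h3, h4⟩ := log3_bounds
  obtain ⟨h5, h6⟩ := log5_bounds
  unfold AA
  constructor <;> linarith

theorem W_upper (n : ℕ) (hn : 30 ≤ n) : W n ≤ AA * n + 4 * Real.log n := by
  have e1 := stir_upper n 1 (by norm_num) (by omega)
  have e2 := stir_lower n 2 (by norm_num) (by omega)
  have e3 := stir_lower n 3 (by norm_num) (by omega)
  have e5 := stir_lower n 5 (by norm_num) (by omega)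
  have e30 := stir_upper n 30 (by norm_num) (by omega)
  rw [Nat.div_one] at e1
  push_cast at e1 e2 e3 e5 e30
  rw [log_30] at e30
  rw [Real.log_one] at e1
  have h1 := Real.log_two_gt_d9
  obtain ⟨h3, h4⟩ := log3_bounds
  obtain ⟨h5, h6⟩ := log5_bounds
  unfold W AA
  nlinarith

theorem W_lower (n : ℕ) (hn : 30 ≤ n) : AA * n - 4 * Real.log n ≤ W n := by
  have e1 := stir_lower n 1 (by norm_num) (by omega)
  have e2 := stir_upper n 2 (by norm_num) (by omega)
  have e3 := stir_upper n 3 (by norm_num) (by omega)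
  have e5 := stir_upper n 5 (by norm_num) (by omega)
  have e30 := stir_lower n 30 (by norm_num) (by omega)
  rw [Nat.div_one] at e1
  push_cast at e1 e2 e3 e5 e30
  rw [log_30] at e30
  rw [Real.log_one] at e1
  have h1 := Real.log_two_gt_d9
  obtain ⟨h3, h4⟩ := log3_bounds
  obtain ⟨h5, h6⟩ := log5_bounds
  have h7 : Real.log 30 ≤ Real.log n := Real.log_le_log (by norm_num) (by exact_mod_cast hn)
  rw [log_30] at h7
  unfold W AA
  nlinarith

theorem ps_mono {a b : ℕ} (h : a ≤ b) : ps a ≤ ps b := by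
  unfold ps
  apply Finset.sum_le_sum_of_subset_of_nonneg (Finset.Ioc_subset_Ioc_right h)
  intro d _ _
  exact vonMangoldt_nonneg

theorem ps_base : ps 30 ≤ 170 := by
  have h := Chebyshev.psi_le_const_mul_self (x := 30) (by norm_num)
  have e : Chebyshev.psi 30 = ps 30 := by
    unfold Chebyshev.psi ps
    norm_num
  rw [e] at h
  have h4 : Real.log 4 = 2 * Real.log 2 := by
    rw [show (4:ℝ) = 2 ^ 2 by norm_num, Real.log_pow]; norm_num
  have h2 := Real.log_two_lt_d9
  linarith

theorem ps_upper (n : ℕ) (hn : 1 ≤ n) : ps n ≤ 6 / 5 * AA * n + 2 * Real.log n ^ 2 + 170 := by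
  induction n using Nat.strong_induction_on with
  | _ n ih =>
    have hA := AA_bounds.1
    have hnr : (1 : ℝ) ≤ n := by exact_mod_cast hn
    by_cases h : n ≤ 30
    · have := (ps_mono h).trans ps_base
      have h2 := sq_nonneg (Real.log n)
      nlinarith
    · have i1 := ih (n / 6) (by omega) (by omega)
      have i2 := le_W n
      have i3 := W_upper n (by omega)
      have i4 : ((n / 6 : ℕ) : ℝ) ≤ n / 6 := Nat.cast_div_le
      have i5 : Real.log ((n / 6 : ℕ) : ℝ) ≤ Real.log n - Real.log 6 := by
        rw [← Real.log_div (by positivity) (by norm_num)]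
        exact Real.log_le_log (by exact_mod_cast (by omega : 0 < n / 6)) i4
      have i6 : 0 ≤ Real.log ((n / 6 : ℕ) : ℝ) := Real.log_natCast_nonneg _
      have i7 : Real.log 6 = Real.log 2 + Real.log 3 := by
        rw [← Real.log_mul (by norm_num) (by norm_num)]; norm_num
      have h7 : Real.log 30 ≤ Real.log n :=
        Real.log_le_log (by norm_num) (by exact_mod_cast (by omega : 30 ≤ n))
      rw [log_30] at h7
      have h1 := Real.log_two_gt_d9
      have h2 := Real.log_two_lt_d9
      obtain ⟨h3, h4⟩ := log3_bounds
      obtain ⟨h5, h6⟩ := log5_bounds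
      have i8 : Real.log ((n / 6 : ℕ) : ℝ) ^ 2 ≤ (Real.log n - Real.log 6) ^ 2 := by gcongr
      have i9 : 1.79 < Real.log 6 := by linarith
      have i10 : Real.log 6 < 1.8 := by linarith
      have i11 : 3.3 < Real.log n := by linarith
      have i12 : 2 * (Real.log n - Real.log 6) ^ 2 + 4 * Real.log n ≤ 2 * Real.log n ^ 2 := by
        nlinarith
      have i13 : 6 / 5 * AA * ((n / 6 : ℕ) : ℝ) ≤ 6 / 5 * AA * (n / 6) := by gcongr
      linarith

theorem ps_eq_ite (n m : ℕ) (h : m ≤ n) :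
    ps m = ∑ d ∈ Finset.Ioc 0 n, vonMangoldt d * (if d ≤ m then 1 else 0) := by
  have hsub : Finset.Ioc 0 m ⊆ Finset.Ioc 0 n := Finset.Ioc_subset_Ioc_right h
  rw [ps, ← Finset.sum_subset hsub]
  · apply Finset.sum_congr rfl
    intro d hd
    rw [if_pos (Finset.mem_Ioc.1 hd).2, mul_one]
  · intro d hd hd2
    simp only [Finset.mem_Ioc] at hd hd2
    rw [if_neg (by omega), mul_zero]

theorem frac_le (n d : ℕ) (hd : 0 < d) (hdn : d ≤ n) :
    (n : ℝ) / d ≤ ((n / d : ℕ) : ℝ) + (1 / 3 * (if d ≤ n then 1 else 0)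
      + 1 / 3 * (if d ≤ 3 * n / 4 then 1 else 0) + 1 / 3 * (if d ≤ 3 * n / 5 then 1 else 0)
      - 1 / 2 * (if d ≤ n / 2 then 1 else 0) + 1 / 2 * (if d ≤ 2 * n / 5 then 1 else 0)) := by
  have hd0 : (0 : ℝ) < d := by exact_mod_cast hd
  have hlt : n < d * (n / d + 1) := Nat.lt_mul_div_succ n hd
  rw [div_le_iff₀ hd0, if_pos hdn]
  by_cases c2 : d ≤ n / 2
  · rw [if_pos c2, if_pos (by omega : d ≤ 3 * n / 4), if_pos (by omega : d ≤ 3 * n / 5)]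
    by_cases c5 : d ≤ 2 * n / 5
    · rw [if_pos c5]
      have : (n : ℝ) ≤ d * (((n / d : ℕ) : ℝ) + 1) := by exact_mod_cast hlt.le
      linarith
    · rw [if_neg c5]
      have hq : 2 ≤ n / d := (Nat.le_div_iff_mul_le hd).2 (by omega)
      have hq' : (2 : ℝ) ≤ ((n / d : ℕ) : ℝ) := by exact_mod_cast hq
      have : 2 * n ≤ 5 * d := by omega
      have : (2 : ℝ) * n ≤ 5 * d := by exact_mod_cast this
      nlinarith
  · rw [if_neg c2, if_neg (by omega : ¬ d ≤ 2 * n / 5)]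
    have hq : 1 ≤ n / d := (Nat.one_le_div_iff hd).2 hdn
    have hq' : (1 : ℝ) ≤ ((n / d : ℕ) : ℝ) := by exact_mod_cast hq
    by_cases c4 : d ≤ 3 * n / 4
    · rw [if_pos c4]
      by_cases c5 : d ≤ 3 * n / 5
      · rw [if_pos c5]
        have : (n : ℝ) ≤ 2 * d := by exact_mod_cast (by omega : n ≤ 2 * d)
        nlinarith
      · rw [if_neg c5]
        have : 3 * (n : ℝ) ≤ 5 * d := by exact_mod_cast (by omega : 3 * n ≤ 5 * d)
        nlinarith
    · rw [if_neg c4, if_neg (by omega : ¬ d ≤ 3 * n / 5)]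
      have : 3 * (n : ℝ) ≤ 4 * d := by exact_mod_cast (by omega : 3 * n ≤ 4 * d)
      nlinarith

theorem n_SS_le (n : ℕ) : n * SS n ≤ Real.log n.factorial + (1 / 3 * ps n + 1 / 3 * ps (3 * n / 4)
    + 1 / 3 * ps (3 * n / 5) - 1 / 2 * ps (n / 2) + 1 / 2 * ps (2 * n / 5)) := by
  rw [log_factorial_eq, ps_eq_ite n n le_rfl, ps_eq_ite n (3 * n / 4) (by omega),
    ps_eq_ite n (3 * n / 5) (by omega), ps_eq_ite n (n / 2) (by omega),
    ps_eq_ite n (2 * n / 5) (by omega), SS]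
  simp only [Finset.mul_sum]
  rw [← Finset.sum_add_distrib, ← Finset.sum_add_distrib, ← Finset.sum_sub_distrib,
    ← Finset.sum_add_distrib, ← Finset.sum_add_distrib]
  apply Finset.sum_le_sum
  intro d hd
  have hd' := Finset.mem_Ioc.1 hd
  have h := mul_le_mul_of_nonneg_left (frac_le n d hd'.1 hd'.2) (@vonMangoldt_nonneg d)
  calc (n : ℝ) * (vonMangoldt d / d) = vonMangoldt d * (n / d) := by ring
    _ ≤ _ := h
    _ = _ := by ring

theorem log_N : Real.log 32768 = 15 * Real.log 2 := by
  rw [show (32768:ℝ) = 2 ^ 15 by norm_num, Real.log_pow]; norm_num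

theorem ps_upper' (n m : ℕ) (x : ℝ) (hm : 1 ≤ m) (hmn : m ≤ n) (hx : (m : ℝ) ≤ x) :
    ps m ≤ 1.1058 * x + 2 * Real.log n ^ 2 + 170 := by
  have h := ps_upper m hm
  have h1 : Real.log m ≤ Real.log n :=
    Real.log_le_log (by exact_mod_cast hm) (by exact_mod_cast hmn)
  have h2 : 0 ≤ Real.log m := Real.log_natCast_nonneg _
  have h3 := AA_bounds.2
  have h4 : (0 : ℝ) ≤ m := by positivity
  have h5 : Real.log m ^ 2 ≤ Real.log n ^ 2 := by gcongr
  nlinarith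

theorem SS_le (n : ℕ) (hn : 32768 ≤ n) : SS n ≤ Real.log n - 0.1 := by
  have hnr : (32768 : ℝ) ≤ n := by exact_mod_cast hn
  have h0 := n_SS_le n
  have c1 := ps_upper' n n n (by omega) le_rfl le_rfl
  have c2 := ps_upper' n (3 * n / 4) (3 * n / 4) (by omega) (by omega)
    (by have := @Nat.cast_div_le ℝ _ _ _ (3 * n) 4; push_cast at this; exact this)
  have c3 := ps_upper' n (3 * n / 5) (3 * n / 5) (by omega) (by omega)
    (by have := @Nat.cast_div_le ℝ _ _ _ (3 * n) 5; push_cast at this; exact this)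
  have c4 := ps_upper' n (2 * n / 5) (2 * n / 5) (by omega) (by omega)
    (by have := @Nat.cast_div_le ℝ _ _ _ (2 * n) 5; push_cast at this; exact this)
  have c5 := (W_lower (n / 2) (by omega)).trans (W_le (n / 2))
  have c6 : (n : ℝ) ≤ 2 * ((n / 2 : ℕ) : ℝ) + 1 := by exact_mod_cast (by omega : n ≤ 2 * (n / 2) + 1)
  have c7 : Real.log ((n / 2 : ℕ) : ℝ) ≤ Real.log n :=
    Real.log_le_log (by exact_mod_cast (by omega : 0 < n / 2)) (by exact_mod_cast Nat.div_le_self n 2)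
  have c8 := log_fact_le n (by omega)
  have hA := AA_bounds.1
  have l2 := Real.log_two_lt_d9
  have e2 : Real.exp 2 ≤ 32768 := by
    have := Real.exp_one_lt_d9
    have h : Real.exp 2 = Real.exp 1 ^ 2 := by rw [← Real.exp_nat_mul]; norm_num
    have := Real.exp_pos 1
    rw [h]; nlinarith
  have hl := Real.log_div_sqrt_antitoneOn (a := 32768) (b := (n : ℝ)) e2 (by simpa using e2.trans hnr) hnr
  simp only at hl
  have hs : 0 < √(n : ℝ) := Real.sqrt_pos.2 (by linarith)
  have hs0 : 0 < √(32768 : ℝ) := Real.sqrt_pos.2 (by norm_num)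
  have hL0 : 0 ≤ Real.log n := Real.log_natCast_nonneg _
  have hl2 : (Real.log n / √(n : ℝ)) ^ 2 ≤ (Real.log 32768 / √(32768 : ℝ)) ^ 2 := by
    gcongr
  rw [div_pow, div_pow, Real.sq_sqrt (by linarith), Real.sq_sqrt (by norm_num), log_N,
    div_le_iff₀ (by linarith)] at hl2
  have hl3 : Real.log n ^ 2 ≤ 0.0033 * n := by
    refine hl2.trans ?_
    have l1 := Real.log_two_gt_d9
    have : (15 * Real.log 2) ^ 2 / 32768 ≤ 0.0033 := by
      rw [div_le_iff₀ (by norm_num)]; nlinarith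
    nlinarith
  have hL1 : 10 ≤ Real.log n := by
    have : Real.log 32768 ≤ Real.log n := Real.log_le_log (by norm_num) hnr
    have l1 := Real.log_two_gt_d9
    rw [log_N] at this; linarith
  have hl4 : Real.log n ≤ 0.00033 * n := by nlinarith
  have c9 : 0.921 * ((n / 2 : ℕ) : ℝ) ≤ AA * ((n / 2 : ℕ) : ℝ) := by gcongr
  have : (n : ℝ) * SS n ≤ n * (Real.log n - 0.1) := by
    nlinarith
  exact le_of_mul_le_mul_left this (by linarith)

theorem SS_succ (m : ℕ) : SS (m + 1) = SS m + vonMangoldt (m + 1) / ((m + 1 : ℕ) : ℝ) := by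
  unfold SS
  rw [Finset.sum_Ioc_succ_top (Nat.zero_le m)]

/-- The exponent in the bound for `pp 32769 (m + 1)`. -/
noncomputable def RR (m : ℕ) : ℝ :=
  (Real.log 32768 - 0.1 - 9.815) / Real.log 32768 + Real.log (Real.log m)
    - Real.log (Real.log 32768) - (Real.log m - 0.1 - SS m) / Real.log m

theorem RR_step (m : ℕ) (hm : 32768 ≤ m) :
    RR m + vonMangoldt (m + 1) / ((m + 1 : ℕ) : ℝ) / Real.log ((m + 1 : ℕ) : ℝ) ≤ RR (m + 1) := by
  have hE := SS_le m hm
  have hm0 : (32768 : ℝ) ≤ m := by exact_mod_cast hm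
  have hL : 0 < Real.log m := Real.log_pos (by linarith)
  have hLL : Real.log m ≤ Real.log ((m + 1 : ℕ) : ℝ) :=
    Real.log_le_log (by linarith) (by push_cast; linarith)
  unfold RR
  rw [SS_succ]
  generalize vonMangoldt (m + 1) / ((m + 1 : ℕ) : ℝ) = a
  generalize Real.log ((m + 1 : ℕ) : ℝ) = L' at *
  generalize Real.log (m : ℝ) = L at *
  have hL' : 0 < L' := by linarith
  have h1 := Real.one_sub_inv_le_log_of_pos (x := L' / L) (by positivity)
  rw [Real.log_div hL'.ne' hL.ne', inv_div] at h1
  have h2 : (L - 0.1 - SS m) / L' ≤ (L - 0.1 - SS m) / L :=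
    div_le_div_of_nonneg_left (by linarith) hL hLL
  have h3 : (L' - 0.1 - (SS m + a)) / L' = (L - 0.1 - SS m) / L' + (1 - L / L') - a / L' := by
    field_simp; ring
  rw [h3]
  linarith

theorem pp_le_exp (m : ℕ) (hm : 32768 ≤ m) : pp 32769 (m + 1) ≤ Real.exp (2 * RR m) := by
  induction m, hm using Nat.le_induction with
  | base =>
    have h := SS_N
    have h0 : (0 : ℝ) < Real.log 32768 := Real.log_pos (by norm_num)
    have : pp 32769 (32768 + 1) = 1 := by simp [pp]
    rw [this]
    apply Real.one_le_exp
    unfold RR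
    have : (Real.log 32768 - 0.1 - SS 32768) / Real.log 32768 ≤
      (Real.log 32768 - 0.1 - 9.815) / Real.log 32768 := by gcongr
    push_cast
    linarith
  | succ m hm ih =>
    have hs := RR_step m hm
    rw [← pp_mul (by omega : 32769 ≤ m + 1) (by omega : m + 1 ≤ m + 1 + 1), pp_succ]
    have h1 : (if (m + 1).Prime then 1 + 2 / ((m + 1 : ℕ) : ℝ) else 1) ≤
        Real.exp (2 * (vonMangoldt (m + 1) / ((m + 1 : ℕ) : ℝ) / Real.log ((m + 1 : ℕ) : ℝ))) := by
      split_ifs with hp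
      · rw [vonMangoldt_apply_prime hp]
        have hl : 0 < Real.log ((m + 1 : ℕ) : ℝ) := Real.log_pos (by exact_mod_cast hp.one_lt)
        have e : Real.log ((m + 1 : ℕ) : ℝ) / ((m + 1 : ℕ) : ℝ) / Real.log ((m + 1 : ℕ) : ℝ)
          = 1 / ((m + 1 : ℕ) : ℝ) := by field_simp
        rw [e]
        have := Real.add_one_le_exp (2 * (1 / ((m + 1 : ℕ) : ℝ)))
        calc _ = 2 * (1 / ((m + 1 : ℕ) : ℝ)) + 1 := by ring
          _ ≤ _ := this
      · apply Real.one_le_exp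
        have := @vonMangoldt_nonneg (m + 1)
        have : 0 ≤ Real.log ((m + 1 : ℕ) : ℝ) := Real.log_natCast_nonneg _
        positivity
    calc _ ≤ Real.exp (2 * RR m) *
          Real.exp (2 * (vonMangoldt (m + 1) / ((m + 1 : ℕ) : ℝ) / Real.log ((m + 1 : ℕ) : ℝ))) := by
          apply mul_le_mul ih h1 _ (Real.exp_pos _).le
          split_ifs <;> positivity
      _ = Real.exp (2 * (RR m + vonMangoldt (m + 1) / ((m + 1 : ℕ) : ℝ) / Real.log ((m + 1 : ℕ) : ℝ))) := by
          rw [← Real.exp_add]; ring_nf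
      _ ≤ _ := by gcongr

theorem exp_num : Real.exp 0.0928 ≤ 1.0974 := by
  have h := Real.exp_bound' (x := 0.0928) (by norm_num) (by norm_num) (n := 3) (by norm_num)
  refine h.trans ?_
  norm_num [Finset.sum_range_succ, Nat.factorial]

theorem large_range (n : ℕ) (hn : 32768 ≤ n) : pp 0 (n + 1) < Real.log n ^ 2 := by
  have l1 := Real.log_two_gt_d9
  have l2 := Real.log_two_lt_d9
  have hn0 : (32768 : ℝ) ≤ n := by exact_mod_cast hn
  have hL : 0 < Real.log n := Real.log_pos (by linarith)
  have h0 : (0 : ℝ) < Real.log 32768 := Real.log_pos (by norm_num)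
  have hE := SS_le n hn
  have h1 := pp_le_exp n hn
  have h2 : RR n ≤ 0.0464 + (Real.log (Real.log n) - Real.log (Real.log 32768)) := by
    unfold RR
    have a1 : 0 ≤ (Real.log n - 0.1 - SS n) / Real.log n := div_nonneg (by linarith) hL.le
    have a2 : (Real.log 32768 - 0.1 - 9.815) / Real.log 32768 ≤ 0.0464 := by
      rw [div_le_iff₀ h0, log_N]; linarith
    linarith
  have h3 : Real.exp (2 * RR n) ≤ 1.0974 * (Real.log n / Real.log 32768) ^ 2 := by
    calc Real.exp (2 * RR n)
        ≤ Real.exp (0.0928 + 2 * (Real.log (Real.log n) - Real.log (Real.log 32768))) := by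
          apply Real.exp_le_exp.2; linarith
      _ = Real.exp 0.0928 * (Real.log n / Real.log 32768) ^ 2 := by
          rw [Real.exp_add, ← Real.log_div hL.ne' h0.ne', ← Nat.cast_two, ← Real.log_pow,
            Real.exp_log (by positivity)]
      _ ≤ _ := by gcongr; exact exp_num
  rw [← pp_mul (by omega : 0 ≤ 32769) (by omega : 32769 ≤ n + 1)]
  have h4 : (0 : ℝ) ≤ pp 32769 (n + 1) := by linarith [one_le_pp 32769 (n + 1)]
  calc pp 0 32769 * pp 32769 (n + 1)
      ≤ 98.41 * (1.0974 * (Real.log n / Real.log 32768) ^ 2) :=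
        mul_le_mul pp_N (h1.trans h3) h4 (by norm_num)
    _ = (98.41 * 1.0974) / (Real.log 32768) ^ 2 * Real.log n ^ 2 := by ring
    _ < 1 * Real.log n ^ 2 := by
        apply mul_lt_mul_of_pos_right _ (by positivity)
        rw [div_lt_one (by positivity), log_N]
        nlinarith
    _ = _ := one_mul _

theorem pp_lt (n : ℕ) (hn : 53 ≤ n) : pp 0 (n + 1) < Real.log n ^ 2 := by
  by_cases h : n < 53 + 2 ^ 15
  · exact small_range n hn h
  · exact large_range n (by norm_num at h; omega)

theorem tau3_le (d : ℕ) : tau3 d ≤ ∑ j ∈ d.divisors, j.divisors.card := by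
  unfold tau3
  rw [← Finset.card_sigma]
  apply Finset.card_le_card_of_injOn (fun t => ⟨t.1 * t.2.1, t.1⟩)
  · rintro ⟨a, b, c⟩ h
    simp only [Finset.coe_filter, Finset.mem_product, Finset.mem_Icc, Set.mem_ofPred_eq] at h
    obtain ⟨⟨ha, hb, hc⟩, h⟩ := h
    simp only [Finset.mem_coe, Finset.mem_sigma, Nat.mem_divisors]
    have hab : 0 < a * b := Nat.mul_pos ha.1 hb.1
    exact ⟨⟨⟨c, h.symm⟩, by omega⟩, ⟨b, rfl⟩, hab.ne'⟩
  · rintro ⟨a, b, c⟩ h ⟨a', b', c'⟩ h' he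
    simp only [Finset.coe_filter, Finset.mem_product, Finset.mem_Icc, Set.mem_ofPred_eq] at h h'
    obtain ⟨⟨ha, hb, hc⟩, h⟩ := h
    obtain ⟨⟨ha', hb', hc'⟩, h'⟩ := h'
    simp only [Sigma.mk.injEq, heq_eq_eq] at he
    obtain ⟨h1, rfl⟩ := he
    have hbb : b = b' := Nat.eq_of_mul_eq_mul_left ha.1 h1
    subst hbb
    have hcc : c = c' := Nat.eq_of_mul_eq_mul_left (Nat.mul_pos ha.1 hb.1) (h.trans h'.symm)
    subst hcc
    rfl

theorem count_le (P j : ℕ) (hj : 0 < j) (D : ℝ) (hD : 1 ≤ D) :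
    ((P.divisors.filter (fun d : ℕ => (d : ℝ) < D ∧ j ∣ d)).card : ℝ) ≤ D / j := by
  have hj0 : (0 : ℝ) < j := by exact_mod_cast hj
  have h : (P.divisors.filter (fun d : ℕ => (d : ℝ) < D ∧ j ∣ d)).card ≤ (Finset.Ioc 0 ⌊D / j⌋₊).card := by
    apply Finset.card_le_card_of_injOn (fun d => d / j)
    · intro d hd
      simp only [Finset.coe_filter, Nat.mem_divisors, Set.mem_ofPred_eq] at hd
      obtain ⟨⟨h1, h2⟩, h3, k, rfl⟩ := hd
      simp only [Finset.coe_Ioc, Set.mem_Ioc]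
      rw [Nat.mul_div_cancel_left k hj]
      refine ⟨Nat.pos_of_ne_zero ?_, Nat.le_floor ?_⟩
      · rintro rfl
        simp only [mul_zero, zero_dvd_iff] at h1
        exact h2 h1
      · rw [le_div_iff₀ hj0]
        push_cast at h3
        linarith
    · intro d hd d' hd' he
      simp only [Finset.coe_filter, Nat.mem_divisors, Set.mem_ofPred_eq] at hd hd'
      exact (Nat.div_left_inj hd.2.2 hd'.2.2).1 he
  rw [Nat.card_Ioc, Nat.sub_zero] at h
  calc _ ≤ ((⌊D / j⌋₊ : ℕ) : ℝ) := by exact_mod_cast h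
    _ ≤ _ := Nat.floor_le (by positivity)

theorem sum_tau_div (P : ℕ) (hsq : Squarefree P) :
    ∑ j ∈ P.divisors, (j.divisors.card : ℝ) / j = ∏ p ∈ P.primeFactors, (1 + 2 / (p : ℝ)) := by
  let f : ArithmeticFunction ℝ := ⟨fun j => (j.divisors.card : ℝ) / j, by simp⟩
  have hf : f.IsMultiplicative := by
    refine ⟨by simp [f], ?_⟩
    intro m n hmn
    simp only [f, coe_mk]
    rw [hmn.card_divisors_mul]
    push_cast
    rw [mul_div_mul_comm]
  have h := hf.prodPrimeFactors_one_add_of_squarefree hsq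
  have e : ∏ p ∈ P.primeFactors, (1 + 2 / (p : ℝ)) = ∏ p ∈ P.primeFactors, (1 + f p) := by
    apply Finset.prod_congr rfl
    intro p hp
    have hp' := Nat.prime_of_mem_primeFactors hp
    have : p.divisors.card = 2 := by
      rw [hp'.divisors, Finset.card_pair hp'.one_lt.ne]
    simp only [f, coe_mk, this, Nat.cast_ofNat]
  rw [e, h]
  rfl

theorem sum_tau3_le (P : ℕ) (hP : 0 < P) (hsq : Squarefree P) (D : ℝ) (hD : 1 ≤ D) :
    (∑ d ∈ P.divisors.filter (fun d : ℕ => (d : ℝ) < D), (tau3 d : ℝ)) ≤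
      D * ∏ p ∈ P.primeFactors, (1 + 2 / (p : ℝ)) := by
  rw [← sum_tau_div P hsq, Finset.mul_sum]
  have hsub : ∀ d ∈ P.divisors.filter (fun d : ℕ => (d : ℝ) < D),
      (tau3 d : ℝ) ≤ ∑ j ∈ P.divisors, if j ∣ d then (j.divisors.card : ℝ) else 0 := by
    intro d hd
    have hd' := Nat.mem_divisors.1 (Finset.mem_filter.1 hd).1
    have h : (tau3 d : ℝ) ≤ ∑ j ∈ d.divisors, (j.divisors.card : ℝ) := by
      exact_mod_cast tau3_le d
    refine h.trans (le_of_eq ?_)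
    rw [← Finset.sum_filter]
    apply Finset.sum_congr _ (fun _ _ => rfl)
    ext j
    simp only [Nat.mem_divisors, Finset.mem_filter]
    constructor
    · rintro ⟨h1, h2⟩
      exact ⟨⟨h1.trans hd'.1, hd'.2⟩, h1⟩
    · rintro ⟨_, h1⟩
      exact ⟨h1, fun h0 => hd'.2 (zero_dvd_iff.1 (h0 ▸ hd'.1))⟩
  refine (Finset.sum_le_sum hsub).trans ?_
  rw [Finset.sum_comm]
  apply Finset.sum_le_sum
  intro j hj
  have hj' := Nat.pos_of_mem_divisors hj
  rw [← Finset.sum_filter, Finset.filter_filter, Finset.sum_const, nsmul_eq_mul]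
  have := count_le P j hj' D hD
  calc _ ≤ D / j * (j.divisors.card : ℝ) := by gcongr
    _ = _ := by ring

theorem pp_split (P N : ℕ) (hP : 0 < P) (hple : ∀ p : ℕ, p.Prime → p ∣ P → p ≤ N) :
    (∏ p ∈ P.primeFactors, (1 + 2 / (p : ℝ))) *
      ∏ p ∈ (Finset.Iic N).filter (fun p => Nat.Prime p ∧ ¬ p ∣ P), (1 + 2 / (p : ℝ)) =
    pp 0 (N + 1) := by
  unfold pp
  rw [← Finset.prod_union]
  · apply Finset.prod_congr _ (fun _ _ => rfl)
    ext p
    simp only [Finset.mem_union, Nat.mem_primeFactors, Finset.mem_filter, Finset.mem_Iic,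
      Finset.mem_Ico]
    constructor
    · rintro (⟨h1, h2, _⟩ | ⟨h1, h2, _⟩)
      · exact ⟨⟨by omega, by have := hple p h1 h2; omega⟩, h1⟩
      · exact ⟨⟨by omega, by omega⟩, h2⟩
    · rintro ⟨⟨_, h1⟩, h2⟩
      by_cases h : p ∣ P
      · exact Or.inl ⟨h2, h, hP.ne'⟩
      · exact Or.inr ⟨by omega, h2, h⟩
  · rw [Finset.disjoint_left]
    intro p hp hp2
    exact (Finset.mem_filter.1 hp2).2.2 (Nat.dvd_of_mem_primeFactors hp)

end T3

theorem sum_tau3_lt (y : ℝ) (hy : 53 ≤ y) (P : ℕ) (hP : 0 < P) (hsq : Squarefree P)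
    (hple : ∀ p : ℕ, p.Prime → p ∣ P → (p : ℝ) ≤ y) (D : ℝ) (hD : 1 ≤ D) :
    (∑ d ∈ P.divisors.filter (fun d : ℕ => (d : ℝ) < D), (tau3 d : ℝ)) <
      D * (Real.log y) ^ 2 *
        ∏ p ∈ (Finset.Iic ⌊y⌋₊).filter (fun p => Nat.Prime p ∧ ¬ p ∣ P),
          (1 + 2 / (p : ℝ))⁻¹ := by
  have hy0 : 0 ≤ y := by linarith
  have hN : 53 ≤ ⌊y⌋₊ := Nat.le_floor (by exact_mod_cast hy)
  have h1 := T3.sum_tau3_le P hP hsq D hD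
  have h2 := T3.pp_split P ⌊y⌋₊ hP (fun p hp hd => Nat.le_floor (hple p hp hd))
  have h3 := T3.pp_lt ⌊y⌋₊ hN
  have hN0 : (53 : ℝ) ≤ (⌊y⌋₊ : ℝ) := by exact_mod_cast hN
  have h4 : Real.log ((⌊y⌋₊ : ℕ) : ℝ) ≤ Real.log y :=
    Real.log_le_log (by linarith) (Nat.floor_le hy0)
  have h5 : 0 ≤ Real.log ((⌊y⌋₊ : ℕ) : ℝ) := Real.log_natCast_nonneg _
  have h6 : Real.log ((⌊y⌋₊ : ℕ) : ℝ) ^ 2 ≤ Real.log y ^ 2 := by gcongr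
  refine h1.trans_lt ?_
  rw [Finset.prod_inv_distrib, mul_assoc]
  apply mul_lt_mul_of_pos_left _ (by linarith)
  rw [← div_eq_mul_inv, lt_div_iff₀ (Finset.prod_pos fun p _ => by positivity), h2]
  exact h3.trans_le h6
end
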